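/- arXiv:1308.2405 — 3 statements merged into one kernel-verified Lean document; each statement's English description precedes it below -/
import Mathlib

section
/- Let n ≥ 100 be an integer, let ε ∈ (0, 1/1000), and let S ∈ ℝ^{n×n} be invertible with least singular value σ_n(S) ≥ 9·√(ln(2n(1 + 1/ε))/π). Let x ∼ D_{ℤ^n,S}. Then for every subset T ⊆ ℤ^n, Pr(x ∈ T) − Pr(x ∈ T + e_1) < 0.39, where e_1 is the first standard unit vector; consequently, if T and T + e_1 are disjoint, then Pr(x ∈ T) ≤ 0.695. -/
open scoped BigOperators Matrix
attribute [local instance] Classical.propDecidable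

/-- Ellipsoidal Gaussian function `ρ_S(x) = exp(-π xᵀ (SᵀS)⁻¹ x)` for a (rank-`n`)
matrix `S ∈ ℝ^{m×n}` and `x ∈ ℝ^n`. -/
noncomputable def rho {m n : ℕ} (S : Matrix (Fin m) (Fin n) ℝ) (x : Fin n → ℝ) : ℝ :=
  Real.exp (-Real.pi * (x ⬝ᵥ ((Sᵀ * S)⁻¹ *ᵥ x)))

/-- Coordinatewise cast of an integer vector to a real vector. -/
def intCast' {k : ℕ} (v : Fin k → ℤ) : Fin k → ℝ := fun i => (v i : ℝ)

/-- Euclidean (ℓ2) norm of a real vector. -/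
noncomputable def enorm' {k : ℕ} (x : Fin k → ℝ) : ℝ := Real.sqrt (∑ i, (x i) ^ 2)

/-- If `R` is positive, even and summable on an additive group and translation by `e` multiplies
it by `exp (-(b y + c))` with `b` odd and `c` small, then translating a set by `e` changes its
`R`-mass by less than `0.27` of the total mass. -/
theorem tsum_sub_tsum_translate_le {G : Type*} [AddCommGroup G] (R b : G → ℝ) (c : ℝ) (e : G)
    (hpos : ∀ y, 0 < R y) (heven : ∀ y, R (-y) = R y) (hodd : ∀ y, b (-y) = -b y)
    (hshift : ∀ y, R (y + e) = R y * Real.exp (-(b y + c))) (hc : c ≤ 1 / 60)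
    (hsum : Summable R) (T : Set G) :
    (∑' y, if y ∈ T then R y else 0)
      - (∑' y, if y ∈ {v | ∃ u ∈ T, v = u + e} then R y else 0) ≤ 0.27 * ∑' y, R y := by
  have hsum' : Summable fun y => R (y + e) := (Equiv.addRight e).summable_iff.mpr hsum
  have htot : ∑' y, R (y + e) = ∑' y, R y := (Equiv.addRight e).tsum_eq R
  have hshiftT : (∑' y, if y ∈ {v | ∃ u ∈ T, v = u + e} then R y else 0)
      = ∑' y, if y ∈ T then R (y + e) else 0 := by
    rw [← (Equiv.addRight e).tsum_eq]
    simp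
  -- the geometric mean of `R` and its translate
  set m : G → ℝ := fun y => R y * Real.exp (-(b y + c) / 2) with hm
  have hmsq : ∀ y, m y ^ 2 = R y * R (y + e) := by
    intro y
    have h : Real.exp (-(b y + c)) = Real.exp (-(b y + c) / 2) ^ 2 := by
      rw [← Real.exp_nat_mul]; congr 1; push_cast; ring
    rw [hshift, hm, h]; ring
  have hmpos : ∀ y, 0 < m y := fun y => mul_pos (hpos y) (Real.exp_pos _)
  have hmle : ∀ y, m y ≤ R y + R (y + e) := by
    intro y
    nlinarith [hmsq y, hmpos y, hpos y, hpos (y + e), sq_nonneg (R y - R (y + e))]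
  have hmsum : Summable m :=
    Summable.of_nonneg_of_le (fun y => (hmpos y).le) hmle (hsum.add hsum')
  have hmneg : Summable fun y => m (-y) := (Equiv.neg G).summable_iff.mpr hmsum
  have hmtot : (1 - c / 2) * ∑' y, R y ≤ ∑' y, m y := by
    have h1 : ∑' y, m (-y) = ∑' y, m y := (Equiv.neg G).tsum_eq m
    have h2 : ∑' y, 2 * ((1 - c / 2) * R y) ≤ ∑' y, (m y + m (-y)) := by
      refine Summable.tsum_le_tsum (fun y => ?_) ((hsum.mul_left _).mul_left _) (hmsum.add hmneg)
      have h3 := Real.add_one_le_exp (-(b y + c) / 2)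
      have h4 := Real.add_one_le_exp (-(b (-y) + c) / 2)
      simp only [hm, heven]
      rw [hodd] at h4 ⊢
      nlinarith [mul_le_mul_of_nonneg_left h3 (hpos y).le,
        mul_le_mul_of_nonneg_left h4 (hpos y).le]
    rw [hmsum.tsum_add hmneg, h1, tsum_mul_left, tsum_mul_left] at h2
    linarith
  have hbound : ∀ y, |R y - R (y + e)| ≤ (401 / 40) * (R y + R (y + e)) - (399 / 20) * m y := by
    intro y
    have hf := Real.sq_sqrt (hpos y).le
    have hg := Real.sq_sqrt (hpos (y + e)).le
    have hfg : m y = √(R y) * √(R (y + e)) := by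
      rw [← Real.sqrt_mul (hpos y).le, ← hmsq, Real.sqrt_sq (hmpos y).le]
    rw [hfg, abs_le]
    constructor <;>
    nlinarith [sq_nonneg (20 * (√(R y) - √(R (y + e))) - (√(R y) + √(R (y + e)))),
      sq_nonneg (20 * (√(R y) - √(R (y + e))) + (√(R y) + √(R (y + e))))]
  have hT : Summable fun y => if y ∈ T then R y else 0 :=
    hsum.indicator T
  have hT' : Summable fun y => if y ∈ T then R (y + e) else 0 :=
    hsum'.indicator T
  have hs1 := (hsum.add hsum').mul_left (401 / 40 : ℝ)
  have hs2 := hmsum.mul_left (399 / 20 : ℝ)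
  have key : ∑' y, ((if y ∈ T then R y else 0) - (if y ∈ T then R (y + e) else 0))
      ≤ ∑' y, ((401 / 40) * (R y + R (y + e)) - (399 / 20) * m y) := by
    refine Summable.tsum_le_tsum (fun y => ?_) (hT.sub hT') (hs1.sub hs2)
    split_ifs
    · exact (le_abs_self _).trans (hbound y)
    · rw [sub_zero]
      exact (abs_nonneg _).trans (hbound y)
  rw [hT.tsum_sub hT', hs1.tsum_sub hs2, tsum_mul_left, tsum_mul_left,
    hsum.tsum_add hsum', htot] at key
  rw [hshiftT]
  have hZ : 0 ≤ ∑' y, R y := tsum_nonneg fun y => (hpos y).le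
  nlinarith [mul_le_mul_of_nonneg_right hc hZ]

/-- Translating the argument of `rho S`. -/
theorem rho_add {m n : ℕ} (S : Matrix (Fin m) (Fin n) ℝ) (x v : Fin n → ℝ) :
    rho S (x + v) = rho S x * Real.exp (-(2 * Real.pi * (x ⬝ᵥ ((Sᵀ * S)⁻¹ *ᵥ v))
      + Real.pi * (v ⬝ᵥ ((Sᵀ * S)⁻¹ *ᵥ v)))) := by
  have hsymm : v ⬝ᵥ ((Sᵀ * S)⁻¹ *ᵥ x) = x ⬝ᵥ ((Sᵀ * S)⁻¹ *ᵥ v) := by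
    rw [Matrix.dotProduct_mulVec, ← Matrix.mulVec_transpose, Matrix.transpose_nonsing_inv,
      Matrix.transpose_mul, Matrix.transpose_transpose, dotProduct_comm]
  rw [rho, rho, ← Real.exp_add]
  congr 1
  simp only [Matrix.mulVec_add, add_dotProduct, dotProduct_add, hsymm]
  ring

theorem rho_neg {m n : ℕ} (S : Matrix (Fin m) (Fin n) ℝ) (x : Fin n → ℝ) :
    rho S (-x) = rho S x := by
  simp [rho, Matrix.mulVec_neg]

theorem enorm'_sq {k : ℕ} (x : Fin k → ℝ) : enorm' x ^ 2 = x ⬝ᵥ x := by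
  rw [enorm', Real.sq_sqrt (Finset.sum_nonneg fun i _ => sq_nonneg _)]
  simp [dotProduct, sq]

/-- The inverse Gram matrix of `S` has quadratic form at most `‖v‖² / σ²` when
`σ ‖x‖ ≤ ‖S x‖` for all `x`. -/
theorem sq_mul_gram_inv_le {n : ℕ} (S : Matrix (Fin n) (Fin n) ℝ) (hS : IsUnit S.det) (σ : ℝ)
    (hσ0 : 0 ≤ σ) (hσ : ∀ x : Fin n → ℝ, σ * enorm' x ≤ enorm' (S *ᵥ x)) (v : Fin n → ℝ) :
    σ ^ 2 * (v ⬝ᵥ ((Sᵀ * S)⁻¹ *ᵥ v)) ≤ v ⬝ᵥ v := by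
  have hdet : IsUnit (Sᵀ * S).det := by
    rw [Matrix.det_mul, Matrix.det_transpose]
    exact hS.mul hS
  set w := (Sᵀ * S)⁻¹ *ᵥ v with hw
  have hv : (Sᵀ * S) *ᵥ w = v := by
    rw [hw, Matrix.mulVec_mulVec, Matrix.mul_nonsing_inv _ hdet, Matrix.one_mulVec]
  have hSw : (S *ᵥ w) ⬝ᵥ (S *ᵥ w) = v ⬝ᵥ w := by
    rw [Matrix.dotProduct_mulVec, ← Matrix.mulVec_transpose, Matrix.mulVec_mulVec, hv]
  have hq0 : 0 ≤ v ⬝ᵥ w := by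
    rw [← hSw, ← enorm'_sq]
    positivity
  have hlow : σ ^ 2 * (w ⬝ᵥ w) ≤ v ⬝ᵥ w := by
    rw [← hSw, ← enorm'_sq, ← enorm'_sq, ← mul_pow]
    exact pow_le_pow_left₀ (mul_nonneg hσ0 (Real.sqrt_nonneg _)) (hσ w) 2
  have hcs : (v ⬝ᵥ w) ^ 2 ≤ (v ⬝ᵥ v) * (w ⬝ᵥ w) := by
    simpa [dotProduct, sq] using Finset.sum_mul_sq_le_sq_mul_sq Finset.univ v w
  have hvv : 0 ≤ v ⬝ᵥ v := by
    rw [← enorm'_sq]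
    positivity
  rcases hq0.eq_or_lt with h | h
  · rw [← h, mul_zero]
    exact hvv
  · refine le_of_mul_le_mul_right ?_ h
    nlinarith [mul_le_mul_of_nonneg_left hcs (sq_nonneg σ), mul_le_mul_of_nonneg_left hlow hvv]

theorem eight_le_log {n : ℕ} (hn : 100 ≤ n) {ε : ℝ} (hε0 : 0 < ε) (hε : ε < 1 / 1000) :
    8 ≤ Real.log (2 * n * (1 + 1 / ε)) := by
  have hn' : (100 : ℝ) ≤ n := by exact_mod_cast hn
  have hinv : 1000 ≤ 1 / ε := by
    rw [le_div_iff₀ hε0]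
    linarith
  have hbig : (6561 : ℝ) ≤ 2 * n * (1 + 1 / ε) := by nlinarith
  rw [Real.le_log_iff_exp_le (by linarith)]
  have h8 : Real.exp 8 = Real.exp 1 ^ 8 := by
    rw [← Real.exp_nat_mul]
    norm_num
  have h3 : Real.exp 1 ^ 8 ≤ 3 ^ 8 :=
    pow_le_pow_left₀ (Real.exp_pos 1).le (by linarith [Real.exp_one_lt_d9]) 8
  rw [h8]
  linarith

/-- the shift estimate inside Claim 4.4. Let `n ≥ 100`, `ε ∈ (0, 1/1000)`,
`S ∈ ℝ^{n×n}` invertible with least singular value `σn ≥ 9·√(ln(2n(1+1/ε))/π)` (characterized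
by `σn‖x‖ ≤ ‖Sx‖`), and let `x ∼ D_{ℤ^n,S}`.  Then for every `T ⊆ ℤ^n`,
`Pr(x ∈ T) − Pr(x ∈ T + e₁) < 0.39`; consequently, if `T` and `T + e₁` are disjoint then
`Pr(x ∈ T) ≤ 0.695`. -/
theorem statement6 {n : ℕ} (hn : 100 ≤ n) (ε : ℝ) (hε0 : 0 < ε) (hε : ε < 1 / 1000)
    (S : Matrix (Fin n) (Fin n) ℝ) (hS : IsUnit S.det)
    (σn : ℝ) (hσn : ∀ x : Fin n → ℝ, σn * enorm' x ≤ enorm' (S *ᵥ x))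
    (hσnB : σn ≥ 9 * Real.sqrt (Real.log (2 * n * (1 + 1 / ε)) / Real.pi))
    (T : Set (Fin n → ℤ))
    (e1 : Fin n → ℤ) (he1 : e1 = fun i : Fin n => if (i : ℕ) = 0 then (1 : ℤ) else 0) :
    ((∑' y : Fin n → ℤ, if y ∈ T then rho S (intCast' y) else 0) /
          (∑' y : Fin n → ℤ, rho S (intCast' y))
        - (∑' y : Fin n → ℤ, if y ∈ {v | ∃ u ∈ T, v = u + e1} then rho S (intCast' y) else 0) /
          (∑' y : Fin n → ℤ, rho S (intCast' y))
      < 0.39)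
    ∧ (Disjoint T {v | ∃ u ∈ T, v = u + e1} →
        (∑' y : Fin n → ℤ, if y ∈ T then rho S (intCast' y) else 0) /
          (∑' y : Fin n → ℤ, rho S (intCast' y)) ≤ 0.695) := by
  by_cases hsum : Summable fun y : Fin n → ℤ => rho S (intCast' y)
  swap
  · rw [tsum_eq_zero_of_not_summable hsum]
    norm_num
  have hpos : ∀ y : Fin n → ℤ, 0 < rho S (intCast' y) := fun y => Real.exp_pos _
  have hZ : 0 < ∑' y : Fin n → ℤ, rho S (intCast' y) :=
    hsum.tsum_pos (fun y => (hpos y).le) 0 (hpos 0)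
  have hσ0 : 0 ≤ σn := le_trans (by positivity) hσnB
  have hσsq : 81 * 8 / Real.pi ≤ σn ^ 2 := by
    have hlog := eight_le_log hn hε0 hε
    have h := pow_le_pow_left₀ (by positivity) hσnB 2
    rw [mul_pow, Real.sq_sqrt (div_nonneg (by linarith) Real.pi_pos.le)] at h
    refine le_trans ?_ h
    rw [mul_div_assoc, show (81 : ℝ) = 9 ^ 2 by norm_num]
    gcongr
  have hnorm : intCast' e1 ⬝ᵥ intCast' e1 = 1 := by
    have h0 : 0 < n := by omega
    rw [dotProduct, Finset.sum_eq_single (⟨0, h0⟩ : Fin n)]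
    · simp [intCast', he1]
    · intro i _ hi
      have : (i : ℕ) ≠ 0 := fun h => hi (Fin.ext h)
      simp [intCast', he1, this]
    · simp
  have hc : Real.pi * (intCast' e1 ⬝ᵥ ((Sᵀ * S)⁻¹ *ᵥ intCast' e1)) ≤ 1 / 60 := by
    have hq := sq_mul_gram_inv_le S hS σn hσ0 hσn (intCast' e1)
    rw [hnorm] at hq
    set q := intCast' e1 ⬝ᵥ ((Sᵀ * S)⁻¹ *ᵥ intCast' e1)
    rcases le_or_gt q 0 with h | h
    · nlinarith [Real.pi_pos]
    · have h1 : 81 * 8 / Real.pi * q ≤ 1 := (mul_le_mul_of_nonneg_right hσsq h.le).trans hq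
      rw [div_mul_eq_mul_div, div_le_one Real.pi_pos] at h1
      nlinarith [Real.pi_pos, Real.pi_lt_d2]
  have hcast_neg : ∀ y : Fin n → ℤ, intCast' (-y) = -intCast' y := fun y => by
    ext i; simp [intCast']
  have hcast_add : ∀ y z : Fin n → ℤ, intCast' (y + z) = intCast' y + intCast' z := fun y z => by
    ext i; simp [intCast']
  have main := tsum_sub_tsum_translate_le (fun y : Fin n → ℤ => rho S (intCast' y))
    (fun y => 2 * Real.pi * (intCast' y ⬝ᵥ ((Sᵀ * S)⁻¹ *ᵥ intCast' e1))) _ e1 hpos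
    (fun y => by simp only [hcast_neg, rho_neg])
    (fun y => by simp only [hcast_neg, neg_dotProduct, mul_neg])
    (fun y => by simp only [hcast_add, rho_add]) hc hsum T
  have hfirst : (∑' y : Fin n → ℤ, if y ∈ T then rho S (intCast' y) else 0) /
          (∑' y : Fin n → ℤ, rho S (intCast' y))
        - (∑' y : Fin n → ℤ, if y ∈ {v | ∃ u ∈ T, v = u + e1} then rho S (intCast' y) else 0) /
          (∑' y : Fin n → ℤ, rho S (intCast' y)) < 0.39 := by
    rw [← sub_div, div_lt_iff₀ hZ]
    linarith
  refine ⟨hfirst, fun hdisj => ?_⟩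
  have hle : (∑' y : Fin n → ℤ, if y ∈ T then rho S (intCast' y) else 0)
      + (∑' y : Fin n → ℤ, if y ∈ {v | ∃ u ∈ T, v = u + e1} then rho S (intCast' y) else 0)
      ≤ ∑' y : Fin n → ℤ, rho S (intCast' y) := by
    have hT := hsum.indicator T
    have hT' := hsum.indicator {v | ∃ u ∈ T, v = u + e1}
    refine (hT.tsum_add hT').symm.trans_le
      (Summable.tsum_le_tsum (fun y => ?_) (hT.add hT') hsum)
    rw [← congrFun (Set.indicator_union_of_disjoint hdisj _) y]
    exact Set.indicator_le_self' (fun _ _ => (hpos y).le) y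
  rw [div_le_iff₀ hZ]
  linarith
end

section
/- Let n be a positive integer, B ≥ 1 a real number with Bn ≥ 16, and t > 0 a real number with ⌊2t⌋ ≥ 2n·log₂(Bn). Let N = ⌊10t⌋ and let x_1,…,x_{N+1} ∈ ℤ^n. For 1 ≤ j ≤ N define S_j = {Σ_{k=1}^{j} α_k x_k : α_k ∈ {−1, 0, 1}} ⊆ ℤ^n, and define Y_j ∈ {0,1} by: Y_j = 1 if and only if S_j ∩ (S_j + e_1) is non-empty, or (x_{j+1} ∉ S_j and ‖x_{j+1}‖_∞ ≤ B). If at least 2t of the values Y_1,…,Y_N equal 1, then S_N ∩ (S_N + e_1) is non-empty. -/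
open scoped BigOperators Matrix
attribute [local instance] Classical.propDecidable

/-- If `x k` is never a `{-1, 0, 1}`-combination of its predecessors for `k ∈ K`, then the subset
sums of `x` over `K` are pairwise distinct. -/
theorem subsetSum_injOn {n : ℕ} (x : ℕ → Fin n → ℤ) (K : Finset ℕ) (hK : ∀ k ∈ K, 1 ≤ k)
    (hx : ∀ k ∈ K, ¬ ∃ α : ℕ → ℤ, (∀ l, α l = -1 ∨ α l = 0 ∨ α l = 1) ∧
      ∀ i : Fin n, x k i = ∑ l ∈ Finset.Icc 1 (k - 1), α l * x l i) :
    Set.InjOn (fun A : Finset ℕ => ∑ k ∈ A, x k) (K.powerset : Set (Finset ℕ)) := by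
  have key : ∀ P Q : Finset ℕ, P ⊆ K → Q ⊆ K → Disjoint P Q → ∀ k ∈ P,
      (∀ l ∈ P ∪ Q, l ≤ k) → ∑ l ∈ P, x l ≠ ∑ l ∈ Q, x l := by
    intro P Q hP hQ hPQ k hk hmax heq
    have hkQ : k ∉ Q := Finset.disjoint_left.mp hPQ hk
    refine hx k (hP hk)
      ⟨fun l => (if l ∈ Q then 1 else 0) - (if l ∈ P.erase k then 1 else 0), ?_, ?_⟩
    · intro l
      by_cases h1 : l ∈ Q <;> by_cases h2 : l ∈ P.erase k <;> simp [h1, h2]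
    · intro i
      have hQs : Finset.Icc 1 (k - 1) ∩ Q = Q := by
        refine Finset.inter_eq_right.mpr fun l hl => ?_
        have h1 := hK l (hQ hl)
        have h2 := hmax l (Finset.mem_union_right _ hl)
        have h3 : l ≠ k := fun h => hkQ (h ▸ hl)
        rw [Finset.mem_Icc]
        omega
      have hPs : Finset.Icc 1 (k - 1) ∩ P.erase k = P.erase k := by
        refine Finset.inter_eq_right.mpr fun l hl => ?_
        obtain ⟨h3, hl⟩ := Finset.mem_erase.mp hl
        have h1 := hK l (hP hl)
        have h2 := hmax l (Finset.mem_union_left _ hl)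
        rw [Finset.mem_Icc]
        omega
      have hi := congrFun heq i
      rw [← Finset.add_sum_erase P x hk] at hi
      simp only [Pi.add_apply, Finset.sum_apply] at hi
      simp only [sub_mul, ite_mul, one_mul, zero_mul, Finset.sum_sub_distrib,
        Finset.sum_ite_mem, hQs, hPs]
      linarith
  intro A hA A' hA' heq
  have hA : A ⊆ K := Finset.mem_powerset.mp hA
  have hA' : A' ⊆ K := Finset.mem_powerset.mp hA'
  by_contra hne
  have hsum : ∑ k ∈ A \ A', x k = ∑ k ∈ A' \ A, x k := by
    rw [← sub_eq_zero, Finset.sum_sdiff_sub_sum_sdiff, sub_eq_zero]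
    exact heq
  have hnon : (A \ A' ∪ A' \ A).Nonempty := by
    rw [Finset.nonempty_iff_ne_empty]
    intro h
    rw [Finset.union_eq_empty, Finset.sdiff_eq_empty_iff_subset,
      Finset.sdiff_eq_empty_iff_subset] at h
    exact hne (h.1.antisymm h.2)
  have hmax : ∀ l ∈ A \ A' ∪ A' \ A, l ≤ (A \ A' ∪ A' \ A).max' hnon :=
    fun l hl => Finset.le_max' _ l hl
  have hdisj : Disjoint (A \ A') (A' \ A) := disjoint_sdiff_sdiff
  rcases Finset.mem_union.mp (Finset.max'_mem _ hnon) with hk | hk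
  · exact key _ _ (Finset.sdiff_subset.trans hA) (Finset.sdiff_subset.trans hA') hdisj _ hk
      hmax hsum
  · exact key _ _ (Finset.sdiff_subset.trans hA') (Finset.sdiff_subset.trans hA) hdisj.symm _ hk
      (fun l hl => hmax l (Finset.union_comm (A' \ A) (A \ A') ▸ hl)) hsum.symm

/-- If the subset sums of integer vectors with entries bounded by `B` are pairwise distinct, then
their number `2 ^ #K` is at most the number of lattice points in a box of side `#K * B`. -/
theorem two_pow_card_le_of_injOn {n : ℕ} (x : ℕ → Fin n → ℤ) (K : Finset ℕ) (B : ℝ)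
    (hB : ∀ k ∈ K, ∀ i, |(x k i : ℝ)| ≤ B)
    (hinj : Set.InjOn (fun A : Finset ℕ => ∑ k ∈ A, x k) (K.powerset : Set (Finset ℕ))) :
    (2 : ℝ) ^ K.card ≤ (K.card * B + 1) ^ n := by
  have hdiff : ∀ i, ∑ k ∈ K, max (x k i) 0 = ∑ k ∈ K, |x k i| + ∑ k ∈ K, min (x k i) 0 := by
    intro i
    rw [← Finset.sum_add_distrib]
    refine Finset.sum_congr rfl fun k _ => ?_
    rcases le_total 0 (x k i) with h | h
    · simp [h, abs_of_nonneg h]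
    · simp [h, abs_of_nonpos h]
  have hcard : K.powerset.card ≤ (Fintype.piFinset fun i : Fin n =>
      Finset.Icc (∑ k ∈ K, min (x k i) 0) (∑ k ∈ K, max (x k i) 0)).card := by
    refine Finset.card_le_card_of_injOn _ (fun A hA => ?_) hinj
    have hA : A ⊆ K := Finset.mem_powerset.mp hA
    simp only [Finset.mem_coe, Fintype.mem_piFinset, Finset.mem_Icc, Finset.sum_apply]
    intro i
    constructor
    · calc ∑ k ∈ K, min (x k i) 0 ≤ ∑ k ∈ A, min (x k i) 0 :=
            Finset.sum_le_sum_of_subset_of_nonpos' hA fun k _ _ => min_le_right _ _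
        _ ≤ ∑ k ∈ A, x k i := Finset.sum_le_sum fun k _ => min_le_left _ _
    · calc ∑ k ∈ A, x k i ≤ ∑ k ∈ A, max (x k i) 0 :=
            Finset.sum_le_sum fun k _ => le_max_left _ _
        _ ≤ ∑ k ∈ K, max (x k i) 0 :=
            Finset.sum_le_sum_of_subset_of_nonneg hA fun k _ _ => le_max_right _ _
  rw [Finset.card_powerset, Fintype.card_piFinset] at hcard
  have hcard' : (2 : ℝ) ^ K.card ≤ ∏ i : Fin n, ((Finset.Icc (∑ k ∈ K, min (x k i) 0)
      (∑ k ∈ K, max (x k i) 0)).card : ℝ) := by exact_mod_cast hcard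
  refine hcard'.trans ((Finset.prod_le_prod (g := fun _ => K.card * B + 1)
    (fun i _ => by positivity) fun i _ => ?_).trans_eq (by simp))
  have hnn : 0 ≤ ∑ k ∈ K, |x k i| + 1 := by positivity
  have hIcc : ((Finset.Icc (∑ k ∈ K, min (x k i) 0) (∑ k ∈ K, max (x k i) 0)).card : ℤ)
      = ∑ k ∈ K, |x k i| + 1 := by
    rw [Int.card_Icc, hdiff, Int.toNat_of_nonneg] <;> linarith
  have hIcc' : ((Finset.Icc (∑ k ∈ K, min (x k i) 0) (∑ k ∈ K, max (x k i) 0)).card : ℝ)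
      = ∑ k ∈ K, |(x k i : ℝ)| + 1 := by exact_mod_cast hIcc
  rw [hIcc']
  have hsum := Finset.sum_le_card_nsmul K _ B fun k hk => hB k hk i
  rw [nsmul_eq_mul] at hsum
  linarith

theorem mul_add_one_lt_two_rpow {u w : ℝ} (hu : 16 ≤ u) (hw : 2 * Real.logb 2 u ≤ w) :
    w * u + 1 < (2 : ℝ) ^ w := by
  have hu0 : 0 < u := by linarith
  have hlog : 4 ≤ Real.logb 2 u := by
    rw [Real.le_logb_iff_rpow_le one_lt_two hu0]
    norm_num
    exact hu
  have hu2 : u ≤ (2 : ℝ) ^ (w / 2) := by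
    rw [← Real.logb_le_iff_le_rpow one_lt_two hu0]
    linarith
  have hw2 : w + 1 ≤ (2 : ℝ) ^ (w / 2) := by
    have h1 : (2 : ℝ) ^ (w / 2) = 2 ^ (w / 2 - 4) * 16 := by
      rw [Real.rpow_sub two_pos]
      norm_num
    have h2 : Real.log 2 * (w / 2 - 4) + 1 ≤ (2 : ℝ) ^ (w / 2 - 4) := by
      rw [Real.rpow_def_of_pos two_pos]
      exact Real.add_one_le_exp _
    have h3 := Real.log_two_gt_d9
    rw [h1]
    nlinarith
  have hsq : (2 : ℝ) ^ w = 2 ^ (w / 2) * 2 ^ (w / 2) := by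
    rw [← Real.rpow_add two_pos]
    ring_nf
  rw [hsq]
  nlinarith

theorem mul_add_one_pow_lt_two_pow {n m : ℕ} (hn : 1 ≤ n) {B : ℝ} (hBn : 16 ≤ B * n)
    (hm : 2 * (n : ℝ) * Real.logb 2 (B * n) ≤ m) : (m * B + 1) ^ n < (2 : ℝ) ^ m := by
  have hn0 : (0 : ℝ) < n := by exact_mod_cast hn
  have hB : 0 ≤ B := by
    by_contra h
    nlinarith
  have hlt := mul_add_one_lt_two_rpow hBn (w := m / n) (by
    rw [le_div_iff₀ hn0]
    linarith)
  have hmB : (m : ℝ) / n * (B * n) = m * B := by field_simp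
  rw [hmB] at hlt
  calc (m * B + 1) ^ n < ((2 : ℝ) ^ ((m : ℝ) / n)) ^ n :=
        pow_lt_pow_left₀ hlt (by positivity) (by omega)
    _ = 2 ^ m := by
        rw [← Real.rpow_natCast, ← Real.rpow_mul zero_le_two, div_mul_cancel₀ _ hn0.ne',
          Real.rpow_natCast]

/-- Claim 4.6. Let `n ≥ 1`, `B ≥ 1` real with `Bn ≥ 16`, `t > 0` with
`⌊2t⌋ ≥ 2n·log₂(Bn)`, `N = ⌊10t⌋`, and `x_1, …, x_{N+1} ∈ ℤ^n`.  With
`S_j = {∑_{k=1}^j α_k x_k : α_k ∈ {−1,0,1}}` and `Y_j = 1` iff `S_j ∩ (S_j + e₁) ≠ ∅` or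
(`x_{j+1} ∉ S_j` and `‖x_{j+1}‖_∞ ≤ B`): if at least `2t` of `Y_1, …, Y_N` equal `1`, then
`S_N ∩ (S_N + e₁)` is non-empty (i.e. some `z ∈ S_N` has `z − e₁ ∈ S_N`). -/
theorem statement8 (n : ℕ) (hn : 1 ≤ n) (B : ℝ) (hB : 1 ≤ B) (hBn : 16 ≤ B * n)
    (t : ℝ) (ht : 0 < t)
    (h2t : 2 * (n : ℝ) * Real.logb 2 (B * n) ≤ (⌊2 * t⌋₊ : ℝ))
    (x : ℕ → Fin n → ℤ)
    (Sset : ℕ → Set (Fin n → ℤ))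
    (hS : ∀ j, Sset j = {z | ∃ α : ℕ → ℤ, (∀ k, α k = -1 ∨ α k = 0 ∨ α k = 1) ∧
        ∀ i : Fin n, z i = ∑ k ∈ Finset.Icc 1 j, α k * x k i})
    (e1 : Fin n → ℤ) (he1 : e1 = fun i : Fin n => if (i : ℕ) = 0 then (1 : ℤ) else 0)
    (Y : ℕ → Prop)
    (hY : ∀ j, Y j ↔ ((∃ z, z ∈ Sset j ∧ z - e1 ∈ Sset j) ∨
        (x (j + 1) ∉ Sset j ∧ ∀ i : Fin n, (|x (j + 1) i| : ℝ) ≤ B)))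
    (hcount : ∃ J : Finset ℕ, J ⊆ Finset.Icc 1 ⌊10 * t⌋₊ ∧ 2 * t ≤ (J.card : ℝ) ∧
        ∀ j ∈ J, Y j) :
    ∃ z, z ∈ Sset ⌊10 * t⌋₊ ∧ z - e1 ∈ Sset ⌊10 * t⌋₊ := by
  obtain ⟨J, hJN, hJcard, hJY⟩ := hcount
  have hmono : ∀ j ≤ ⌊10 * t⌋₊, Sset j ⊆ Sset ⌊10 * t⌋₊ := by
    intro j hj z hz
    rw [hS] at hz ⊢
    obtain ⟨α, hα, hz⟩ := hz
    refine ⟨fun k => if k ≤ j then α k else 0, fun k => ?_, fun i => ?_⟩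
    · by_cases h : k ≤ j
      · simpa [h] using hα k
      · simp [h]
    · rw [hz i, ← Finset.sum_subset (Finset.Icc_subset_Icc_right hj)]
      · refine Finset.sum_congr rfl fun k hk => ?_
        simp [(Finset.mem_Icc.mp hk).2]
      · intro k hk hk'
        have h : ¬ k ≤ j := fun h => hk' (Finset.mem_Icc.mpr ⟨(Finset.mem_Icc.mp hk).1, h⟩)
        simp [h]
  by_cases hex : ∃ j ∈ J, ∃ z, z ∈ Sset j ∧ z - e1 ∈ Sset j
  · obtain ⟨j, hj, z, hz, hz'⟩ := hex
    have hle := hmono j (Finset.mem_Icc.mp (hJN hj)).2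
    exact ⟨z, hle hz, hle hz'⟩
  exfalso
  have hnew : ∀ j ∈ J, x (j + 1) ∉ Sset j ∧ ∀ i : Fin n, |(x (j + 1) i : ℝ)| ≤ B := by
    intro j hj
    rcases (hY j).mp (hJY j hj) with h | h
    · exact absurd ⟨j, hj, h⟩ hex
    · exact_mod_cast h
  set K := J.image (· + 1) with hKdef
  have hKcard : K.card = J.card := Finset.card_image_of_injective _ (add_left_injective 1)
  have hinj := subsetSum_injOn x K
    (fun k hk => by
      obtain ⟨j, -, rfl⟩ := Finset.mem_image.mp hk
      omega)
    (fun k hk => by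
      obtain ⟨j, hj, rfl⟩ := Finset.mem_image.mp hk
      have h := (hnew j hj).1
      rw [hS] at h
      exact h)
  have hle := two_pow_card_le_of_injOn x K B
    (fun k hk => by
      obtain ⟨j, hj, rfl⟩ := Finset.mem_image.mp hk
      exact (hnew j hj).2) hinj
  rw [hKcard] at hle
  have hfloor := Nat.floor_le (by positivity : 0 ≤ 2 * t)
  exact hle.not_gt (mul_add_one_pow_lt_two_pow hn hBn (by linarith))
end

section
/- Let m > n ≥ 100 be integers and ε ∈ (0, 1/1000). Let R ∈ ℝ^{m×m} be invertible, c ∈ ℝ^m, and S ∈ ℝ^{n×n} invertible, and let X ∈ ℤ^{n×m} have its m columns drawn independently from D_{ℤ^n,S}. If m ≥ 30·n·log₂(σ_1(S)·n), σ_m(R) ≥ 10·n·σ_1(S)·log₂(m)·√(log₂(1/ε)·log₂(n·σ_1(S))), and σ_n(S) ≥ 9·√(ln(2n(1 + 1/ε))/π), then with probability at least 1 − 2^{−n} over the choice of X, the statistical distance between E_{X,R,c} and the discrete Gaussian D_{ℤ^n + Xc, RXᵀ} is at most 2ε. -/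
open scoped BigOperators Matrix
attribute [local instance] Classical.propDecidable

/-- The probability that `E_{X,R,c}` (the distribution of `X·v` for `v ← D_{ℤ^m + c, R}`)
assigns to the point `z ∈ ℝ^n`. -/
noncomputable def Edist {n m : ℕ} (X : Matrix (Fin n) (Fin m) ℝ)
    (R : Matrix (Fin m) (Fin m) ℝ) (c : Fin m → ℝ) (z : Fin n → ℝ) : ℝ :=
  (∑' v : Fin m → ℤ, if X *ᵥ (intCast' v + c) = z then rho R (intCast' v + c) else 0) /
  (∑' v : Fin m → ℤ, rho R (intCast' v + c))

/-- The statistical distance `Δ(E_{X,R,c}, D_{ℤ^n + Xc, RXᵀ})`: both distributions are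
supported inside `ℤ^n + Xc`, whose points are parametrized injectively by `w ∈ ℤ^n`. -/
noncomputable def statDist {n m : ℕ} (X : Matrix (Fin n) (Fin m) ℤ)
    (R : Matrix (Fin m) (Fin m) ℝ) (c : Fin m → ℝ) : ℝ :=
  (1 / 2) * ∑' w : Fin n → ℤ,
    |Edist (X.map (Int.cast : ℤ → ℝ)) R c (intCast' w + (X.map (Int.cast : ℤ → ℝ)) *ᵥ c)
      - rho (R * (X.map (Int.cast : ℤ → ℝ))ᵀ) (intCast' w + (X.map (Int.cast : ℤ → ℝ)) *ᵥ c) /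
          (∑' u : Fin n → ℤ,
            rho (R * (X.map (Int.cast : ℤ → ℝ))ᵀ)
              (intCast' u + (X.map (Int.cast : ℤ → ℝ)) *ᵥ c))|

theorem hasSum_pi_prod {ι : Type*} {k : ℕ} {f : Fin k → ι → ℝ} {a : Fin k → ℝ}
    (hf0 : ∀ i x, 0 ≤ f i x) (hf : ∀ i, HasSum (f i) (a i)) :
    HasSum (fun v : Fin k → ι => ∏ i, f i (v i)) (∏ i, a i) := by
  induction k with
  | zero => simp [hasSum_unique]
  | succ k ih =>
    have ih := ih (fun i => hf0 i.succ) fun i => hf i.succ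
    have hg0 : 0 ≤ fun v : Fin k → ι => ∏ i, f (Fin.succ i) (v i) :=
      fun v => Finset.prod_nonneg fun i _ => hf0 _ _
    have h1 := (hf 0).summable.mul_of_nonneg ih.summable (show 0 ≤ f 0 from hf0 0) hg0
    have h2 := (hf 0).mul ih h1
    rw [← (Fin.consEquiv (fun _ : Fin (k + 1) => ι)).hasSum_iff, Fin.prod_univ_succ]
    have h3 : ((fun v : Fin (k + 1) → ι => ∏ i, f i (v i)) ∘ (Fin.consEquiv fun _ => ι)) =
        fun x : ι × (Fin k → ι) => f 0 x.1 * ∏ i, f (Fin.succ i) (x.2 i) := by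
      funext x
      simp [Fin.prod_univ_succ, Fin.consEquiv]
    rw [h3]
    exact h2

theorem summable_exp_neg_mul_int_sq {c : ℝ} (hc : 0 < c) :
    Summable fun n : ℤ => Real.exp (-c * (n : ℝ) ^ 2) := by
  have h : 0 < (Complex.I * (c / Real.pi : ℝ)).im := by
    simp; positivity
  have := (summable_jacobiTheta₂_term_iff 0 (Complex.I * (c / Real.pi : ℝ))).2 h
  have h2 := this.norm
  convert h2 using 2 with n
  rw [norm_jacobiTheta₂_term]
  simp
  field_simp

theorem dotProduct_mulVec_le {k l : ℕ} (D : Matrix (Fin k) (Fin l) ℝ) (z : Fin l → ℝ) :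
    (D *ᵥ z) ⬝ᵥ (D *ᵥ z) ≤ (∑ i, ∑ j, D i j ^ 2) * (z ⬝ᵥ z) := by
  simp only [dotProduct, Matrix.mulVec, ← sq]
  rw [Finset.sum_mul]
  refine Finset.sum_le_sum fun i _ => ?_
  exact Finset.sum_mul_sq_le_sq_mul_sq _ _ _

theorem exists_mul_dotProduct_le {k : ℕ} {C : Matrix (Fin k) (Fin k) ℝ} (hC : IsUnit C.det) :
    ∃ c : ℝ, 0 < c ∧ ∀ y : Fin k → ℝ, c * (y ⬝ᵥ y) ≤ (C *ᵥ y) ⬝ᵥ (C *ᵥ y) := by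
  set K : ℝ := ∑ i, ∑ j, C⁻¹ i j ^ 2
  have hK : 0 ≤ K := Finset.sum_nonneg fun i _ => Finset.sum_nonneg fun j _ => sq_nonneg _
  refine ⟨(K + 1)⁻¹, by positivity, fun y => ?_⟩
  have h := dotProduct_mulVec_le C⁻¹ (C *ᵥ y)
  rw [Matrix.mulVec_mulVec, Matrix.nonsing_inv_mul _ hC, Matrix.one_mulVec] at h
  have h0 : 0 ≤ (C *ᵥ y) ⬝ᵥ (C *ᵥ y) := by
    simpa using dotProduct_star_self_nonneg (C *ᵥ y)
  rw [inv_mul_le_iff₀ (by positivity)]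
  nlinarith

/-- A Gaussian on `ℝ^k` is dominated, uniformly over translates from a bounded set, by a summable
function on `ℤ^k`. -/
theorem exists_summable_bound_gaussian {k : ℕ} {C : Matrix (Fin k) (Fin k) ℝ} (hC : IsUnit C.det)
    (B : ℝ) : ∃ u : (Fin k → ℤ) → ℝ, Summable u ∧ ∀ (x : Fin k → ℝ), (∀ i, |x i| ≤ B) →
      ∀ v : Fin k → ℤ, Real.exp (-Real.pi *
        ((C *ᵥ (intCast' v + x)) ⬝ᵥ (C *ᵥ (intCast' v + x)))) ≤ u v := by
  obtain ⟨c, hc, hcy⟩ := exists_mul_dotProduct_le hC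
  have hs := summable_exp_neg_mul_int_sq (c := Real.pi * c / 2) (by positivity)
  have hp := (hasSum_pi_prod (k := k) (fun _ x => (Real.exp_pos _).le) fun _ => hs.hasSum).summable
  refine ⟨_, hp.mul_left (Real.exp (Real.pi * c * k * B ^ 2)), fun x hx v => ?_⟩
  rw [← Real.exp_sum, ← Real.exp_add, Real.exp_le_exp]
  have h1 := hcy (intCast' v + x)
  have h2 : (∑ i, (v i : ℝ) ^ 2) / 2 - k * B ^ 2 ≤ (intCast' v + x) ⬝ᵥ (intCast' v + x) := by
    have : (k : ℝ) * B ^ 2 = ∑ i : Fin k, B ^ 2 := by simp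
    rw [this, Finset.sum_div, ← Finset.sum_sub_distrib]
    refine Finset.sum_le_sum fun i _ => ?_
    have h3 : x i ^ 2 ≤ B ^ 2 := sq_le_sq' (by linarith [abs_le.1 (hx i)]) (abs_le.1 (hx i)).2
    simp only [Pi.add_apply, intCast']
    nlinarith [sq_nonneg ((v i : ℝ) + 2 * x i)]
  have h4 : c * ((∑ i, (v i : ℝ) ^ 2) / 2 - k * B ^ 2) ≤
      (C *ᵥ (intCast' v + x)) ⬝ᵥ (C *ᵥ (intCast' v + x)) :=
    (mul_le_mul_of_nonneg_left h2 hc.le).trans h1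
  have h5 := mul_le_mul_of_nonneg_left h4 Real.pi_pos.le
  rw [← Finset.mul_sum]
  nlinarith

theorem summable_gaussian_int {k : ℕ} {C : Matrix (Fin k) (Fin k) ℝ} (hC : IsUnit C.det)
    (x : Fin k → ℝ) : Summable fun v : Fin k → ℤ => Real.exp (-Real.pi *
        ((C *ᵥ (intCast' v + x)) ⬝ᵥ (C *ᵥ (intCast' v + x)))) := by
  obtain ⟨u, hu, h⟩ := exists_summable_bound_gaussian hC (∑ i, |x i|)
  exact hu.of_nonneg_of_le (fun v => (Real.exp_pos _).le)
    (h x fun i => Finset.single_le_sum (f := fun i => |x i|) (fun j _ => abs_nonneg _)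
      (Finset.mem_univ i))

theorem continuous_gaussian {k : ℕ} (C : Matrix (Fin k) (Fin k) ℝ) :
    Continuous fun x : Fin k → ℝ => Real.exp (-Real.pi * ((C *ᵥ x) ⬝ᵥ (C *ᵥ x))) := by
  simp only [dotProduct, Matrix.mulVec]
  fun_prop

theorem continuous_tsum_gaussian {k : ℕ} {C : Matrix (Fin k) (Fin k) ℝ} (hC : IsUnit C.det) :
    Continuous fun x : Fin k → ℝ => ∑' v : Fin k → ℤ, Real.exp (-Real.pi *
        ((C *ᵥ (intCast' v + x)) ⬝ᵥ (C *ᵥ (intCast' v + x)))) := by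
  rw [continuous_iff_continuousAt]
  intro x₀
  obtain ⟨u, hu, h⟩ := exists_summable_bound_gaussian hC (‖x₀‖ + 1)
  have hon : ContinuousOn (fun x : Fin k → ℝ => ∑' v : Fin k → ℤ, Real.exp (-Real.pi *
        ((C *ᵥ (intCast' v + x)) ⬝ᵥ (C *ᵥ (intCast' v + x))))) (Metric.ball 0 (‖x₀‖ + 1)) := by
    refine continuousOn_tsum (u := u) (fun v => ?_) hu fun v x hx => ?_
    · exact ((continuous_gaussian C).comp (continuous_const.add continuous_id)).continuousOn
    · rw [Real.norm_of_nonneg (Real.exp_pos _).le]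
      refine h x (fun i => ?_) v
      have h1 : ‖x‖ < ‖x₀‖ + 1 := by simpa using hx
      exact (norm_le_pi_norm x i).trans h1.le
  exact hon.continuousAt (Metric.isOpen_ball.mem_nhds (by simp))

theorem integrable_gaussian {k : ℕ} {C : Matrix (Fin k) (Fin k) ℝ} (hC : IsUnit C.det) :
    MeasureTheory.Integrable fun x : Fin k → ℝ =>
      Real.exp (-Real.pi * ((C *ᵥ x) ⬝ᵥ (C *ᵥ x))) := by
  obtain ⟨c, hc, hcy⟩ := exists_mul_dotProduct_le hC
  have h1 : MeasureTheory.Integrable fun x : Fin k → ℝ =>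
      ∏ i, Real.exp (-(Real.pi * c) * x i ^ 2) :=
    MeasureTheory.Integrable.fintype_prod fun i => integrable_exp_neg_mul_sq (by positivity)
  refine h1.mono' (continuous_gaussian C).aestronglyMeasurable (Filter.Eventually.of_forall ?_)
  intro x
  rw [Real.norm_of_nonneg (Real.exp_pos _).le, ← Real.exp_sum, Real.exp_le_exp, ← Finset.mul_sum]
  have := mul_le_mul_of_nonneg_left (hcy x) Real.pi_pos.le
  simp only [dotProduct, ← sq] at this ⊢
  nlinarith

theorem integral_cexp_mul_gaussian {k : ℕ} {C : Matrix (Fin k) (Fin k) ℝ} (hC : IsUnit C.det)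
    (g : Fin k → ℝ) :
    ∫ x : Fin k → ℝ, Complex.exp (-(2 * Real.pi * Complex.I) * ((g ⬝ᵥ x : ℝ) : ℂ)) *
        ((Real.exp (-Real.pi * ((C *ᵥ x) ⬝ᵥ (C *ᵥ x))) : ℝ) : ℂ) =
      ((|C.det|⁻¹ * Real.exp (-Real.pi * ((C⁻¹ᵀ *ᵥ g) ⬝ᵥ (C⁻¹ᵀ *ᵥ g))) : ℝ) : ℂ) := by
  set d := C⁻¹ᵀ *ᵥ g with hd
  have hdet : C.det ≠ 0 := hC.ne_zero
  set H : (Fin k → ℝ) → ℂ := fun y =>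
    Complex.exp (-(Real.pi : ℂ) * ∑ i, (y i : ℂ) ^ 2 + ∑ i, (-(2 * Real.pi * Complex.I) * d i) * y i)
  have hHc : Continuous H := by fun_prop
  have h1 : ∀ x : Fin k → ℝ, Complex.exp (-(2 * Real.pi * Complex.I) * ((g ⬝ᵥ x : ℝ) : ℂ)) *
        ((Real.exp (-Real.pi * ((C *ᵥ x) ⬝ᵥ (C *ᵥ x))) : ℝ) : ℂ) = H (Matrix.toLin' C x) := by
    intro x
    have h2 : g ⬝ᵥ x = d ⬝ᵥ (C *ᵥ x) := by
      rw [hd, Matrix.mulVec_transpose, ← Matrix.dotProduct_mulVec, Matrix.mulVec_mulVec,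
        Matrix.nonsing_inv_mul _ hC, Matrix.one_mulVec]
    rw [h2, Complex.ofReal_exp, ← Complex.exp_add, Matrix.toLin'_apply]
    simp only [H]
    congr 1
    simp only [dotProduct]
    push_cast
    rw [add_comm, Finset.mul_sum, Finset.mul_sum, Finset.mul_sum]
    congr 1
    · exact Finset.sum_congr rfl fun i _ => by ring
    · exact Finset.sum_congr rfl fun i _ => by ring
  simp_rw [h1]
  have hm := Real.map_matrix_volume_pi_eq_smul_volume_pi hdet
  have hcont : Continuous (Matrix.toLin' C) := LinearMap.continuous_of_finiteDimensional _
  rw [← MeasureTheory.integral_map hcont.measurable.aemeasurable hHc.aestronglyMeasurable, hm,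
    MeasureTheory.integral_smul_measure]
  have h3 := GaussianFourier.integral_cexp_neg_mul_sum_add (ι := Fin k) (b := (Real.pi : ℂ))
    (by simpa using Real.pi_pos) (fun i => -(2 * Real.pi * Complex.I) * d i)
  rw [h3, div_self (by exact_mod_cast Real.pi_ne_zero), Complex.one_cpow, one_mul,
    ENNReal.toReal_ofReal (abs_nonneg _), abs_inv, Complex.ofReal_mul, Complex.real_smul,
    Complex.ofReal_exp]
  congr 2
  simp only [dotProduct]
  push_cast
  rw [Finset.mul_sum, Finset.sum_div]
  refine Finset.sum_congr rfl fun i _ => ?_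
  have : (Real.pi : ℂ) ≠ 0 := by exact_mod_cast Real.pi_ne_zero
  field_simp
  rw [Complex.I_sq]
  ring

/-- Unfolding: integrals over integer translates of the unit cube add up to the integral over the
whole space. -/
theorem hasSum_integral_unit_cube {k : ℕ} {E : Type*} [NormedAddCommGroup E] [NormedSpace ℝ E]
    {φ : (Fin k → ℝ) → E} (hφ : MeasureTheory.Integrable φ) :
    HasSum (fun v : Fin k → ℤ =>
      ∫ x in {x : Fin k → ℝ | ∀ i, x i ∈ Set.Ioc (0 : ℝ) (0 + 1)}, φ (intCast' v + x))
      (∫ x, φ x) := by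
  set s : Set (Fin k → ℝ) := {x | ∀ i, x i ∈ Set.Ioc (0 : ℝ) (0 + 1)} with hs
  have hsm : MeasurableSet s := by
    have : s = Set.univ.pi fun _ => Set.Ioc (0 : ℝ) (0 + 1) := by ext x; simp [hs, Set.mem_pi]
    rw [this]
    exact MeasurableSet.univ_pi fun _ => measurableSet_Ioc
  set t : (Fin k → ℤ) → Set (Fin k → ℝ) := fun v => (fun x => intCast' v + x) '' s with ht
  have htmem : ∀ v y, y ∈ t v ↔ ∀ i, y i - v i ∈ Set.Ioc (0 : ℝ) (0 + 1) := by
    intro v y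
    constructor
    · rintro ⟨x, hx, rfl⟩ i
      simpa [intCast'] using hx i
    · intro h
      refine ⟨fun i => y i - v i, h, ?_⟩
      funext i
      simp [intCast']
  have hemb : ∀ v : Fin k → ℤ, MeasurableEmbedding fun x : Fin k → ℝ => intCast' v + x :=
    fun v => measurableEmbedding_addLeft _
  have hU : ⋃ v, t v = Set.univ := by
    refine Set.eq_univ_of_forall fun y => Set.mem_iUnion.2 ⟨fun i => ⌈y i⌉ - 1, ?_⟩
    rw [htmem]
    intro i
    have h1 := Int.ceil_lt_add_one (y i)
    have h2 := Int.le_ceil (y i)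
    push_cast
    constructor <;> linarith
  have hd : Pairwise (Function.onFun Disjoint t) := by
    intro v w hvw
    refine Set.disjoint_left.2 fun y hv hw => hvw (funext fun i => ?_)
    have h1 := (htmem v y).1 hv i
    have h2 := (htmem w y).1 hw i
    simp only [zero_add, Set.mem_Ioc] at h1 h2
    have h3 : ((v i - w i : ℤ) : ℝ) < 1 := by push_cast; linarith
    have h4 : ((w i - v i : ℤ) : ℝ) < 1 := by push_cast; linarith
    have h5 : v i - w i < 1 := by exact_mod_cast h3
    have h6 : w i - v i < 1 := by exact_mod_cast h4
    omega
  have h := MeasureTheory.hasSum_integral_iUnion (μ := MeasureTheory.volume) (f := φ) (s := t)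
    (fun v => (hemb v).measurableSet_image.2 hsm) hd hφ.integrableOn
  rw [hU, MeasureTheory.setIntegral_univ] at h
  convert h using 2 with v
  exact ((MeasureTheory.measurePreserving_add_left MeasureTheory.volume
    (intCast' v)).setIntegral_image_emb (hemb v) φ s).symm

theorem integral_unit_cube_tsum {k : ℕ} {φ : (Fin k → ℝ) → ℂ} (hφ : MeasureTheory.Integrable φ) :
    ∫ x in {x : Fin k → ℝ | ∀ i, x i ∈ Set.Ioc (0 : ℝ) (0 + 1)},
      ∑' v : Fin k → ℤ, φ (intCast' v + x) = ∫ x, φ x := by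
  have h1 := hasSum_integral_unit_cube hφ
  have h2 := MeasureTheory.hasSum_integral_of_summable_integral_norm
    (F := fun (v : Fin k → ℤ) x => φ (intCast' v + x))
    (fun v => ((MeasureTheory.measurePreserving_add_left MeasureTheory.volume
      (intCast' v)).integrable_comp_of_integrable hφ).integrableOn)
    (hasSum_integral_unit_cube hφ.norm).summable
  exact h2.unique h1

theorem mFourier_coe {k : ℕ} (n : Fin k → ℤ) (x : Fin k → ℝ) :
    UnitAddTorus.mFourier n (fun i => ((x i : ℝ) : UnitAddCircle)) =
      Complex.exp (2 * Real.pi * Complex.I * ((intCast' n ⬝ᵥ x : ℝ) : ℂ)) := by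
  simp only [UnitAddTorus.mFourier, ContinuousMap.coe_mk, fourier_coe_apply]
  rw [← Complex.exp_sum]
  congr 1
  simp only [dotProduct, intCast']
  push_cast
  rw [Finset.mul_sum]
  exact Finset.sum_congr rfl fun i _ => by simp; ring

/-- Poisson summation for a Gaussian on `ℝ^k` and the lattice `ℤ^k`. -/
theorem hasSum_poisson_gaussian {k : ℕ} {C : Matrix (Fin k) (Fin k) ℝ} (hC : IsUnit C.det)
    (τ : Fin k → ℝ) :
    HasSum (fun g : Fin k → ℤ => |C.det|⁻¹ *
        Real.exp (-Real.pi * ((C⁻¹ᵀ *ᵥ intCast' g) ⬝ᵥ (C⁻¹ᵀ *ᵥ intCast' g))) *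
        Real.cos (2 * Real.pi * (intCast' g ⬝ᵥ τ)))
      (∑' v : Fin k → ℤ, Real.exp (-Real.pi *
        ((C *ᵥ (intCast' v + τ)) ⬝ᵥ (C *ᵥ (intCast' v + τ))))) := by
  set f : (Fin k → ℝ) → ℝ := fun x => Real.exp (-Real.pi * ((C *ᵥ x) ⬝ᵥ (C *ᵥ x))) with hf
  set F : (Fin k → ℝ) → ℂ := fun x => ((∑' v : Fin k → ℤ, f (intCast' v + x) : ℝ) : ℂ) with hF
  have hFc : Continuous F := Complex.continuous_ofReal.comp (continuous_tsum_gaussian hC)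
  have hFper : ∀ x (w : Fin k → ℤ), F (intCast' w + x) = F x := by
    intro x w
    simp only [hF]
    congr 1
    rw [← (Equiv.addRight w).tsum_eq fun v : Fin k → ℤ => f (intCast' v + x)]
    refine tsum_congr fun v => congrArg f ?_
    funext i
    simp [intCast', add_assoc]
  set p : C(Fin k → ℝ, UnitAddTorus (Fin k)) :=
    ⟨fun x i => ((x i : ℝ) : UnitAddCircle), by
      refine continuous_pi fun i => ?_
      exact (AddCircle.continuous_mk' 1).comp (continuous_apply i)⟩ with hp
  have hq : Topology.IsQuotientMap p :=
    (IsOpenQuotientMap.piMap (f := fun (_ : Fin k) (y : ℝ) => (y : UnitAddCircle))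
      fun _ => QuotientAddGroup.isOpenQuotientMap_mk).isQuotientMap
  have hfac : Function.FactorsThrough (⟨F, hFc⟩ : C(Fin k → ℝ, ℂ)) p := by
    intro x y hxy
    have h1 : ∀ i, ∃ a : ℤ, (a : ℝ) = x i - y i := fun i => by
      have h2 := QuotientAddGroup.eq_iff_sub_mem.1 (congrFun hxy i)
      obtain ⟨a, ha⟩ := AddSubgroup.mem_zmultiples_iff.1 h2
      exact ⟨a, by simpa using ha⟩
    choose a ha using h1
    have h3 : x = intCast' a + y := by
      funext i
      simp [intCast', ha]
    change F x = F y
    rw [h3, hFper]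
  set G : C(UnitAddTorus (Fin k), ℂ) := hq.lift ⟨F, hFc⟩ hfac with hG
  have hGp : ∀ x : Fin k → ℝ, G (fun i => ((x i : ℝ) : UnitAddCircle)) = F x := fun x =>
    congrArg (fun g : C(Fin k → ℝ, ℂ) => g x) (hq.lift_comp ⟨F, hFc⟩ hfac)
  have hcoef : ∀ g : Fin k → ℤ, UnitAddTorus.mFourierCoeff G g =
      ((|C.det|⁻¹ * Real.exp (-Real.pi *
        ((C⁻¹ᵀ *ᵥ intCast' g) ⬝ᵥ (C⁻¹ᵀ *ᵥ intCast' g))) : ℝ) : ℂ) := by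
    intro g
    rw [UnitAddTorus.mFourierCoeff_eq_integral G g 0, ← integral_cexp_mul_gaussian hC]
    set φ : (Fin k → ℝ) → ℂ := fun x =>
      Complex.exp (-(2 * Real.pi * Complex.I) * ((intCast' g ⬝ᵥ x : ℝ) : ℂ)) * (f x : ℂ) with hφ
    have hφi : MeasureTheory.Integrable φ := by
      have hfi := (integrable_gaussian hC).ofReal (𝕜 := ℂ)
      refine hfi.bdd_mul (c := 1) (Continuous.aestronglyMeasurable ?_)
        (Filter.Eventually.of_forall fun x => ?_)
      · simp only [dotProduct]
        fun_prop
      · rw [show -(2 * Real.pi * Complex.I) * ((intCast' g ⬝ᵥ x : ℝ) : ℂ) =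
          ((-(2 * Real.pi * (intCast' g ⬝ᵥ x)) : ℝ) : ℂ) * Complex.I by push_cast; ring,
          Complex.norm_exp_ofReal_mul_I]
    change _ = ∫ x, φ x
    rw [← integral_unit_cube_tsum hφi]
    refine MeasureTheory.integral_congr_ae (Filter.Eventually.of_forall fun x => ?_)
    change UnitAddTorus.mFourier (-g) (fun i => ((x i : ℝ) : UnitAddCircle)) •
      G (fun i => ((x i : ℝ) : UnitAddCircle)) = ∑' v : Fin k → ℤ, φ (intCast' v + x)
    rw [hGp, mFourier_coe, smul_eq_mul]
    simp only [hF]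
    rw [Complex.ofReal_tsum, ← tsum_mul_left]
    refine tsum_congr fun v => ?_
    simp only [hφ]
    congr 1
    rw [Complex.exp_eq_exp_iff_exists_int]
    refine ⟨∑ i, g i * v i, ?_⟩
    simp only [dotProduct, intCast', Pi.add_apply, Pi.neg_apply]
    push_cast
    simp only [mul_add, Finset.sum_add_distrib, neg_mul, Finset.sum_neg_distrib]
    ring
  have hsum : Summable (UnitAddTorus.mFourierCoeff G) := by
    have hC' : IsUnit (C⁻¹ᵀ).det := by
      rw [Matrix.det_transpose]
      exact Matrix.isUnit_nonsing_inv_det _ hC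
    have h := ((summable_gaussian_int hC' 0).mul_left |C.det|⁻¹)
    simp only [add_zero] at h
    rw [funext hcoef]
    exact Complex.ofRealCLM.summable h
  have h := UnitAddTorus.hasSum_mFourier_series_apply_of_summable hsum
    (fun i => ((τ i : ℝ) : UnitAddCircle))
  rw [hGp] at h
  have h2 := Complex.hasSum_re h
  simp only [hF, Complex.ofReal_re] at h2
  convert h2 using 2 with g
  rw [hcoef, mFourier_coe, smul_eq_mul, Complex.re_ofReal_mul]
  congr 1
  rw [show 2 * Real.pi * Complex.I * ((intCast' g ⬝ᵥ τ : ℝ) : ℂ) =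
    ((2 * Real.pi * (intCast' g ⬝ᵥ τ) : ℝ) : ℂ) * Complex.I by push_cast; ring,
    Complex.exp_ofReal_mul_I_re]

/-- Union bound for independent samples: if no sample falls in `B`, and for no `a ∈ s` all samples
fall in `A a`, then the outcome is good. -/
theorem one_sub_le_tsum_good {ι κ : Type*} {m : ℕ} {p : ι → ℝ} (hp0 : ∀ x, 0 ≤ p x)
    (hp1 : HasSum p 1) (s : Finset κ) (A : κ → ι → Prop) (B : ι → Prop) {P b : ℝ}
    (hA : ∀ a ∈ s, ∑' x, (if A a x then p x else 0) ≤ P)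
    (hB : ∑' x, (if B x then p x else 0) ≤ b) (good : (Fin m → ι) → Prop)
    (hgood : ∀ X : Fin m → ι, (∀ j, ¬ B (X j)) → (∀ a ∈ s, ∃ j, ¬ A a (X j)) → good X) :
    1 - m * b - s.card * P ^ m ≤ ∑' X : Fin m → ι, if good X then ∏ j, p (X j) else 0 := by
  have hind0 : ∀ (Q : ι → Prop) x, 0 ≤ if Q x then p x else 0 := fun Q x => by
    split_ifs
    exacts [hp0 x, le_rfl]
  have hindle : ∀ (Q : ι → Prop) x, (if Q x then p x else 0) ≤ p x := fun Q x => by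
    split_ifs
    exacts [le_rfl, hp0 x]
  have hind : ∀ Q : ι → Prop, Summable fun x => if Q x then p x else 0 := fun Q =>
    hp1.summable.of_nonneg_of_le (hind0 Q) (hindle Q)
  have hW0 : ∀ X : Fin m → ι, 0 ≤ ∏ j, p (X j) := fun X => Finset.prod_nonneg fun j _ => hp0 _
  have hW : HasSum (fun X : Fin m → ι => ∏ j, p (X j)) 1 := by
    simpa using hasSum_pi_prod (k := m) (fun _ => hp0) fun _ => hp1
  have hG : Summable fun X : Fin m → ι => if good X then ∏ j, p (X j) else 0 :=
    hW.summable.of_nonneg_of_le (fun X => by split_ifs; exacts [hW0 X, le_rfl])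
      fun X => by split_ifs; exacts [le_rfl, hW0 X]
  have h1 : ∀ j₀ : Fin m, HasSum (fun X : Fin m → ι =>
      ∏ j, if j = j₀ then (if B (X j) then p (X j) else 0) else p (X j))
      (∑' x, if B x then p x else 0) := by
    intro j₀
    have h := hasSum_pi_prod (k := m)
      (f := fun j x => if j = j₀ then (if B x then p x else 0) else p x)
      (a := fun j => if j = j₀ then (∑' x, if B x then p x else 0) else 1)
      (fun j x => by
        by_cases hj : j = j₀
        · simpa only [hj, if_true] using hind0 B x
        · simpa only [hj, if_false] using hp0 x)
      (fun j => by
        by_cases hj : j = j₀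
        · simpa only [hj, if_true] using (hind B).hasSum
        · simpa only [hj, if_false] using hp1)
    rwa [Finset.prod_ite_eq' Finset.univ j₀, if_pos (Finset.mem_univ _)] at h
  have h2 : ∀ a ∈ s, HasSum (fun X : Fin m → ι =>
      ∏ j, if A a (X j) then p (X j) else 0) ((∑' x, if A a x then p x else 0) ^ m) := by
    intro a _
    simpa using hasSum_pi_prod (k := m) (fun _ => hind0 (A a)) fun _ => (hind (A a)).hasSum
  have h3 := (hG.hasSum.add (hasSum_sum fun j₀ (_ : j₀ ∈ Finset.univ) => h1 j₀)).add
    (hasSum_sum h2)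
  have h4 := hasSum_le (fun X => ?_) hW h3
  · have h5 : ∑ a ∈ s, (∑' x, if A a x then p x else 0) ^ m ≤ s.card * P ^ m := by
      rw [← nsmul_eq_mul]
      exact Finset.sum_le_card_nsmul _ _ _ fun a ha =>
        pow_le_pow_left₀ (tsum_nonneg (hind0 (A a))) (hA a ha) m
    have h6 : ∑ j₀ : Fin m, ∑' x, (if B x then p x else 0) ≤ m * b := by
      simpa using mul_le_mul_of_nonneg_left hB (Nat.cast_nonneg m)
    linarith
  · have hn1 : ∀ j₀ ∈ (Finset.univ : Finset (Fin m)),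
        0 ≤ ∏ j, if j = j₀ then (if B (X j) then p (X j) else 0) else p (X j) := fun j₀ _ =>
      Finset.prod_nonneg fun j _ => by split_ifs <;> first | exact hp0 _ | exact le_rfl
    have hn2 : ∀ a ∈ s, 0 ≤ ∏ j, if A a (X j) then p (X j) else 0 := fun a _ =>
      Finset.prod_nonneg fun j _ => hind0 _ _
    have hs1 := Finset.sum_nonneg hn1
    have hs2 := Finset.sum_nonneg hn2
    have hG0 : 0 ≤ if good X then ∏ j, p (X j) else 0 := by
      split_ifs
      exacts [hW0 X, le_rfl]
    by_cases hb : ∃ j₀, B (X j₀)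
    · obtain ⟨j₀, hj₀⟩ := hb
      have h5 := Finset.single_le_sum hn1 (Finset.mem_univ j₀)
      have h6 : (∏ j, if j = j₀ then (if B (X j) then p (X j) else 0) else p (X j)) =
          ∏ j, p (X j) := Finset.prod_congr rfl fun j _ => by
        by_cases hj : j = j₀
        · rw [if_pos hj, hj, if_pos hj₀]
        · rw [if_neg hj]
      rw [h6] at h5
      linarith
    · by_cases ha : ∃ a ∈ s, ∀ j, A a (X j)
      · obtain ⟨a, has, ha⟩ := ha
        have h5 := Finset.single_le_sum hn2 has
        have h6 : (∏ j, if A a (X j) then p (X j) else 0) = ∏ j, p (X j) :=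
          Finset.prod_congr rfl fun j _ => if_pos (ha j)
        rw [h6] at h5
        linarith
      · push Not at hb ha
        rw [if_pos (hgood X hb ha)]
        linarith

theorem intCast'_add {k : ℕ} (v w : Fin k → ℤ) : intCast' (v + w) = intCast' v + intCast' w := by
  funext i
  simp [intCast']

theorem intCast'_neg {k : ℕ} (v : Fin k → ℤ) : intCast' (-v) = -intCast' v := by
  funext i
  simp [intCast']

theorem summable_gaussian_int_zero {k : ℕ} {C : Matrix (Fin k) (Fin k) ℝ} (hC : IsUnit C.det) :
    Summable fun v : Fin k → ℤ =>
      Real.exp (-Real.pi * ((C *ᵥ intCast' v) ⬝ᵥ (C *ᵥ intCast' v))) := by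
  simpa using summable_gaussian_int hC 0

/-- Discrete Gaussian mass of a symmetric set that is disjoint from one of its translates. -/
theorem gaussian_mass_le_of_disjoint_translate {k : ℕ} {C : Matrix (Fin k) (Fin k) ℝ}
    (hC : IsUnit C.det) (A : (Fin k → ℤ) → Prop) (e : Fin k → ℤ) (hneg : ∀ x, A x → A (-x))
    (hdisj : ∀ x, A x → ¬ A (x + e)) :
    (1 + Real.exp (-Real.pi * ((C *ᵥ intCast' e) ⬝ᵥ (C *ᵥ intCast' e)))) *
      ∑' x, (if A x then Real.exp (-Real.pi * ((C *ᵥ intCast' x) ⬝ᵥ (C *ᵥ intCast' x))) else 0) ≤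
    ∑' x : Fin k → ℤ, Real.exp (-Real.pi * ((C *ᵥ intCast' x) ⬝ᵥ (C *ᵥ intCast' x))) := by
  set f : (Fin k → ℤ) → ℝ := fun x =>
    Real.exp (-Real.pi * ((C *ᵥ intCast' x) ⬝ᵥ (C *ᵥ intCast' x))) with hf
  have hf0 : ∀ x, 0 ≤ f x := fun x => (Real.exp_pos _).le
  have hfs : Summable f := summable_gaussian_int_zero hC
  have hfneg : ∀ x, f (-x) = f x := fun x => by simp [hf, intCast'_neg, Matrix.mulVec_neg]
  have hpar : ∀ x, 2 * (f e * f x) ≤ f (x + e) + f (x + -e) := by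
    intro x
    have h := sq_nonneg (Real.exp (-Real.pi * ((C *ᵥ intCast' (x + e)) ⬝ᵥ
      (C *ᵥ intCast' (x + e))) / 2) - Real.exp (-Real.pi * ((C *ᵥ intCast' (x + -e)) ⬝ᵥ
      (C *ᵥ intCast' (x + -e))) / 2))
    rw [sub_sq, ← Real.exp_nat_mul, ← Real.exp_nat_mul, mul_assoc 2, ← Real.exp_add] at h
    have h1 : f e * f x = Real.exp (-Real.pi * ((C *ᵥ intCast' (x + e)) ⬝ᵥ
      (C *ᵥ intCast' (x + e))) / 2 + -Real.pi * ((C *ᵥ intCast' (x + -e)) ⬝ᵥ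
      (C *ᵥ intCast' (x + -e))) / 2) := by
      simp only [hf]
      rw [← Real.exp_add]
      congr 1
      simp only [intCast'_add, intCast'_neg, Matrix.mulVec_add, Matrix.mulVec_neg,
        dotProduct_add, add_dotProduct, dotProduct_neg, neg_dotProduct]
      ring
    rw [← h1] at h
    have h2 : ∀ t : ℝ, ((2 : ℕ) : ℝ) * (t / 2) = t := fun t => by push_cast; ring
    rw [h2, h2] at h
    simp only [hf] at h ⊢
    linarith
  have hAneg : ∀ x, A (-x) ↔ A x := fun x => ⟨fun h => by simpa using hneg _ h, hneg x⟩
  have hsum : ∀ g : (Fin k → ℤ) → ℝ, (∀ x, 0 ≤ g x) → Summable g →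
      Summable fun x => if A x then g x else 0 := fun g h0 hg =>
    hg.of_nonneg_of_le (fun x => by split_ifs; exacts [h0 x, le_rfl])
      fun x => by split_ifs; exacts [le_rfl, h0 x]
  have hs : ∀ w, Summable fun x => f (x + w) := fun w => (Equiv.addRight w).summable_iff.2 hfs
  have hI := hsum f hf0 hfs
  have hJ := hsum _ (fun x => hf0 (x + e)) (hs e)
  have hJ' := hsum _ (fun x => hf0 (x + -e)) (hs (-e))
  have h1 : ∑' x, (if A x then f (x + -e) else 0) = ∑' x, if A x then f (x + e) else 0 := by
    rw [← (Equiv.neg (Fin k → ℤ)).tsum_eq]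
    refine tsum_congr fun x => ?_
    simp only [Equiv.neg_apply, hAneg]
    rw [← hfneg (x + e), neg_add]
  have h2 : ∑' x, (if A x then f (x + e) else 0) + ∑' x, (if A x then f x else 0) ≤ ∑' x, f x := by
    have h3 := (Equiv.addRight (-e)).summable_iff.2 hJ
    rw [← (Equiv.addRight (-e)).tsum_eq fun x => if A x then f (x + e) else 0]
    refine (h3.tsum_add hI).symm.trans_le ((h3.add hI).tsum_le_tsum (fun y => ?_) hfs)
    simp only [Function.comp, Equiv.coe_addRight, neg_add_cancel_right]
    by_cases hy : A y
    · have hy' : ¬ A (y + -e) := fun h => hdisj _ h (by simpa using hy)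
      simp [hy, hy']
    · by_cases hy' : A (y + -e) <;> simp [hy, hy', hf0]
  have h4 : 2 * (f e * ∑' x, (if A x then f x else 0)) ≤
      ∑' x, (if A x then f (x + e) else 0) + ∑' x, (if A x then f (x + -e) else 0) := by
    rw [← tsum_mul_left, ← tsum_mul_left, ← hJ.tsum_add hJ']
    refine ((hI.mul_left _).mul_left _).tsum_le_tsum (fun x => ?_) (hJ.add hJ')
    by_cases hx : A x
    · simpa [hx] using hpar x
    · simp [hx]
  rw [h1] at h4
  change (1 + f e) * ∑' x, (if A x then f x else 0) ≤ ∑' x, f x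
  linarith

/-- A Gaussian of half the width loses at most a factor `2 ^ k` of its lattice sum. -/
theorem tsum_gaussian_half_le {k : ℕ} {C : Matrix (Fin k) (Fin k) ℝ} (hC : IsUnit C.det) :
    ∑' x : Fin k → ℤ, Real.exp (-Real.pi * ((C *ᵥ intCast' x) ⬝ᵥ (C *ᵥ intCast' x)) / 4) ≤
      2 ^ k * ∑' x : Fin k → ℤ, Real.exp (-Real.pi * ((C *ᵥ intCast' x) ⬝ᵥ (C *ᵥ intCast' x))) := by
  have hC' : IsUnit ((1 / 2 : ℝ) • C).det := by
    rw [Matrix.det_smul]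
    exact (IsUnit.pow _ (by norm_num)).mul hC
  have h1 := hasSum_poisson_gaussian hC 0
  have h2 := hasSum_poisson_gaussian hC' 0
  have hinv : ((1 / 2 : ℝ) • C)⁻¹ᵀ = (2 : ℝ) • C⁻¹ᵀ := by
    rw [← Matrix.transpose_smul]
    congr 1
    refine Matrix.inv_eq_right_inv ?_
    rw [smul_mul_smul_comm, Matrix.mul_nonsing_inv _ hC]
    norm_num
  simp only [dotProduct_zero, mul_zero, Real.cos_zero, mul_one, add_zero] at h1 h2
  rw [hinv, Matrix.det_smul, Fintype.card_fin] at h2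
  have h3 := hasSum_le (fun g => ?_) h2 (h1.mul_left (2 ^ k))
  · refine le_trans (le_of_eq (tsum_congr fun x => ?_)) h3
    congr 1
    simp only [Matrix.smul_mulVec, smul_dotProduct, dotProduct_smul, smul_eq_mul]
    ring
  · rw [← mul_assoc]
    refine mul_le_mul (le_of_eq ?_) (Real.exp_le_exp.2 ?_) (Real.exp_pos _).le (by positivity)
    · rw [abs_mul, mul_inv]
      simp
    · have h0 : 0 ≤ (C⁻¹ᵀ *ᵥ intCast' g) ⬝ᵥ (C⁻¹ᵀ *ᵥ intCast' g) := by
        simpa using dotProduct_star_self_nonneg (C⁻¹ᵀ *ᵥ intCast' g)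
      simp only [Matrix.smul_mulVec, smul_dotProduct, dotProduct_smul, smul_eq_mul]
      nlinarith [Real.pi_pos]

/-- Tail bound for the discrete Gaussian. -/
theorem gaussian_tail_le {k : ℕ} {C : Matrix (Fin k) (Fin k) ℝ} (hC : IsUnit C.det) (t : ℝ) :
    ∑' x : Fin k → ℤ, (if t < (C *ᵥ intCast' x) ⬝ᵥ (C *ᵥ intCast' x) then
      Real.exp (-Real.pi * ((C *ᵥ intCast' x) ⬝ᵥ (C *ᵥ intCast' x))) else 0) ≤
    2 ^ k * Real.exp (-(3 / 4 * Real.pi * t)) *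
      ∑' x : Fin k → ℤ, Real.exp (-Real.pi * ((C *ᵥ intCast' x) ⬝ᵥ (C *ᵥ intCast' x))) := by
  have hC' : IsUnit ((1 / 2 : ℝ) • C).det := by
    rw [Matrix.det_smul]
    exact (IsUnit.pow _ (by norm_num)).mul hC
  have hs : Summable fun x : Fin k → ℤ =>
      Real.exp (-Real.pi * ((C *ᵥ intCast' x) ⬝ᵥ (C *ᵥ intCast' x)) / 4) := by
    convert summable_gaussian_int_zero hC' using 3 with x
    simp only [Matrix.smul_mulVec, smul_dotProduct, dotProduct_smul, smul_eq_mul]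
    ring
  have h1 : ∀ x : Fin k → ℤ, (if t < (C *ᵥ intCast' x) ⬝ᵥ (C *ᵥ intCast' x) then
      Real.exp (-Real.pi * ((C *ᵥ intCast' x) ⬝ᵥ (C *ᵥ intCast' x))) else 0) ≤
      Real.exp (-(3 / 4 * Real.pi * t)) *
        Real.exp (-Real.pi * ((C *ᵥ intCast' x) ⬝ᵥ (C *ᵥ intCast' x)) / 4) := by
    intro x
    split_ifs with h
    · rw [← Real.exp_add, Real.exp_le_exp]
      nlinarith [Real.pi_pos]
    · positivity
  have h2 : Summable fun x : Fin k → ℤ => (if t < (C *ᵥ intCast' x) ⬝ᵥ (C *ᵥ intCast' x) then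
      Real.exp (-Real.pi * ((C *ᵥ intCast' x) ⬝ᵥ (C *ᵥ intCast' x))) else 0) :=
    (hs.mul_left _).of_nonneg_of_le (fun x => by split_ifs; exacts [(Real.exp_pos _).le, le_rfl]) h1
  refine (h2.tsum_le_tsum h1 (hs.mul_left _)).trans ?_
  rw [tsum_mul_left, mul_comm (2 ^ k), mul_assoc (Real.exp _)]
  exact mul_le_mul_of_nonneg_left (tsum_gaussian_half_le hC) (Real.exp_pos _).le

/-- If the image of `Xᵀ` is a saturated sublattice of `ℤ^m` and `Xᵀ` is injective, then `X` has an
integral right inverse, and the kernel of `X` has an integral basis that is a direct summand. -/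
theorem exists_integral_splitting {n m : ℕ} (X : Matrix (Fin n) (Fin m) ℤ)
    (hinj : Function.Injective fun w => Xᵀ *ᵥ w)
    (hsat : ∀ (r : ℤ) (g : Fin m → ℤ) (w : Fin n → ℤ), r ≠ 0 → Xᵀ *ᵥ w = r • g →
      ∃ w' : Fin n → ℤ, Xᵀ *ᵥ w' = g) :
    ∃ (k : ℕ) (M : Matrix (Fin m) (Fin k) ℤ) (P : Matrix (Fin k) (Fin m) ℤ)
      (B : Matrix (Fin m) (Fin n) ℤ), X * B = 1 ∧ X * M = 0 ∧ P * M = 1 ∧ B * X + M * P = 1 := by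
  set N : Submodule ℤ (Fin m → ℤ) := LinearMap.range Xᵀ.mulVecLin with hN
  have : Module.IsTorsionFree ℤ ((Fin m → ℤ) ⧸ N) := by
    refine Module.IsTorsionFree.of_smul_eq_zero fun r q h => ?_
    obtain ⟨g, rfl⟩ := N.mkQ_surjective q
    by_cases hr : r = 0
    · exact Or.inl hr
    · right
      rw [← map_smul, Submodule.mkQ_apply, Submodule.Quotient.mk_eq_zero] at h
      obtain ⟨w, hw⟩ := h
      obtain ⟨w', hw'⟩ := hsat r g w hr hw
      rw [Submodule.mkQ_apply, Submodule.Quotient.mk_eq_zero]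
      exact ⟨w', hw'⟩
  have : Module.Free ℤ ((Fin m → ℤ) ⧸ N) := Module.free_of_finite_type_torsion_free'
  let b := Module.finBasis ℤ ((Fin m → ℤ) ⧸ N)
  set k := Module.finrank ℤ ((Fin m → ℤ) ⧸ N)
  let e : ((Fin m → ℤ) ⧸ N) ≃ₗ[ℤ] (Fin k → ℤ) := b.equivFun
  obtain ⟨s, hs⟩ := Module.projective_lifting_property N.mkQ LinearMap.id N.mkQ_surjective
  let μ : (Fin m → ℤ) →ₗ[ℤ] (Fin k → ℤ) := e.toLinearMap ∘ₗ N.mkQ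
  let π : (Fin k → ℤ) →ₗ[ℤ] (Fin m → ℤ) := s ∘ₗ e.symm.toLinearMap
  have hμπ : μ ∘ₗ π = LinearMap.id := by
    ext1 i
    ext1
    have := LinearMap.congr_fun hs (e.symm (Pi.single i 1))
    simp only [LinearMap.comp_apply, LinearMap.id_apply] at this
    simp [μ, π, this]
  have hμX : ∀ w, μ (Xᵀ *ᵥ w) = 0 := by
    intro w
    have : N.mkQ (Xᵀ *ᵥ w) = 0 := by
      rw [Submodule.mkQ_apply, Submodule.Quotient.mk_eq_zero]
      exact ⟨w, rfl⟩
    simp [μ, this]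
  have hker : ∀ z : Fin m → ℤ, ∃ w, Xᵀ *ᵥ w = z - π (μ z) := by
    intro z
    have h1 : z - π (μ z) ∈ N := by
      rw [← Submodule.Quotient.mk_eq_zero, ← Submodule.mkQ_apply, map_sub, sub_eq_zero]
      have := LinearMap.congr_fun hs (N.mkQ z)
      simp only [LinearMap.comp_apply, LinearMap.id_apply] at this
      simp only [π, μ, LinearMap.comp_apply, LinearEquiv.coe_coe, LinearEquiv.symm_apply_apply,
        this]
    obtain ⟨w, hw⟩ := h1
    exact ⟨w, hw⟩
  choose β hβ using fun i : Fin m => hker (Pi.single i 1)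
  set Mt := LinearMap.toMatrix' μ with hMt
  set Pt := LinearMap.toMatrix' π with hPt
  have hMP : Mt * Pt = 1 := by
    rw [hMt, hPt, ← LinearMap.toMatrix'_comp, hμπ, LinearMap.toMatrix'_id]
  have hMX : Mt * Xᵀ = 0 := by
    refine Matrix.mulVec_injective (funext fun w => ?_)
    rw [← Matrix.mulVec_mulVec, LinearMap.toMatrix'_mulVec, hμX]
    simp
  have hXB : Xᵀ * (Matrix.of β)ᵀ + Pt * Mt = 1 := by
    refine Matrix.ext_of_mulVec_single fun i => ?_
    rw [Matrix.add_mulVec, ← Matrix.mulVec_mulVec, ← Matrix.mulVec_mulVec,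
      LinearMap.toMatrix'_mulVec, LinearMap.toMatrix'_mulVec, Matrix.mulVec_single_one]
    change Xᵀ *ᵥ β i + _ = _
    rw [hβ, sub_add_cancel, Matrix.one_mulVec]
  refine ⟨k, Mtᵀ, Ptᵀ, Matrix.of β, ?_, ?_, ?_, ?_⟩
  · have h : (Matrix.of β)ᵀ * Xᵀ = 1 := by
      refine Matrix.mulVec_injective (funext fun w => hinj ?_)
      simp only [Matrix.mulVec_mulVec]
      congr 1
      rw [← Matrix.mul_assoc, eq_sub_of_add_eq hXB, Matrix.sub_mul, Matrix.mul_assoc, hMX]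
      simp
    simpa [Matrix.transpose_mul] using congrArg Matrix.transpose h
  · simpa [Matrix.transpose_mul] using congrArg Matrix.transpose hMX
  · simpa [Matrix.transpose_mul] using congrArg Matrix.transpose hMP
  · simpa [Matrix.transpose_mul] using congrArg Matrix.transpose hXB

/-- A nonnegatively reweighted distribution whose weights are nearly constant is statistically close
to the original one. -/
theorem half_tsum_abs_sub_le {ι : Type*} {ρ h : ι → ℝ} {K ε : ℝ} (hρ0 : ∀ w, 0 ≤ ρ w)
    (hρs : Summable ρ) (hρ : 0 < ∑' w, ρ w) (hK : 0 < K) (hε0 : 0 < ε) (hε : ε ≤ 1 / 2)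
    (hh : ∀ w, |h w - K| ≤ K * ε) :
    (1 / 2) * ∑' w, |ρ w * h w / (∑' u, ρ u * h u) - ρ w / ∑' u, ρ u| ≤ 2 * ε := by
  have hlo : ∀ w, K * (1 - ε) ≤ h w := fun w => by linarith [(abs_le.1 (hh w)).1]
  have hhi : ∀ w, h w ≤ K * (1 + ε) := fun w => by linarith [(abs_le.1 (hh w)).2]
  have h0 : 0 < K * (1 - ε) := mul_pos hK (by linarith)
  have hs : Summable fun w => ρ w * h w :=
    (hρs.mul_right (K * (1 + ε))).of_nonneg_of_le
      (fun w => mul_nonneg (hρ0 w) (h0.le.trans (hlo w)))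
      fun w => mul_le_mul_of_nonneg_left (hhi w) (hρ0 w)
  set Z := ∑' w, ρ w with hZ
  set D := ∑' w, ρ w * h w with hD
  have hDlo : Z * (K * (1 - ε)) ≤ D := by
    rw [hZ, ← tsum_mul_right]
    exact (hρs.mul_right _).tsum_le_tsum
      (fun w => mul_le_mul_of_nonneg_left (hlo w) (hρ0 w)) hs
  have hDhi : D ≤ Z * (K * (1 + ε)) := by
    rw [hZ, ← tsum_mul_right]
    exact hs.tsum_le_tsum
      (fun w => mul_le_mul_of_nonneg_left (hhi w) (hρ0 w)) (hρs.mul_right _)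
  have hDpos : 0 < D := (mul_pos hρ h0).trans_le hDlo
  have hpt : ∀ w, |ρ w * h w / D - ρ w / Z| ≤ ρ w * (4 * ε / Z) := by
    intro w
    have h1 : ρ w * h w / D - ρ w / Z = ρ w * ((h w * Z - D) / (D * Z)) := by
      field_simp
    rw [h1, abs_mul, abs_of_nonneg (hρ0 w)]
    refine mul_le_mul_of_nonneg_left ?_ (hρ0 w)
    rw [abs_div, abs_of_pos (mul_pos hDpos hρ), div_le_div_iff₀ (mul_pos hDpos hρ) hρ]
    have h2 : |h w * Z - D| ≤ 2 * K * ε * Z := by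
      have := mul_le_mul_of_nonneg_right (hlo w) hρ.le
      have := mul_le_mul_of_nonneg_right (hhi w) hρ.le
      rw [abs_le]
      constructor <;> linarith
    have h3 : 2 * K * Z ≤ 4 * D := by nlinarith [mul_pos hρ hK]
    calc |h w * Z - D| * Z ≤ 2 * K * ε * Z * Z := mul_le_mul_of_nonneg_right h2 hρ.le
      _ = (2 * K * Z) * (ε * Z) := by ring
      _ ≤ (4 * D) * (ε * Z) := mul_le_mul_of_nonneg_right h3 (by positivity)
      _ = 4 * ε * (D * Z) := by ring
  have hfin := (hρs.mul_right (4 * ε / Z)).of_nonneg_of_le (fun w => abs_nonneg _) hpt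
  have := hfin.tsum_le_tsum hpt (hρs.mul_right (4 * ε / Z))
  rw [tsum_mul_right, ← hZ, mul_div_cancel₀ _ hρ.ne'] at this
  linarith

/-- If the dual Gaussian sum is close to `1`, the Gaussian sum over all translates of `ℤ^k` is nearly
constant. -/
theorem abs_tsum_gaussian_sub_le {k : ℕ} {C : Matrix (Fin k) (Fin k) ℝ} (hC : IsUnit C.det)
    {ε : ℝ} (hε : ∑' g : Fin k → ℤ,
      Real.exp (-Real.pi * ((C⁻¹ᵀ *ᵥ intCast' g) ⬝ᵥ (C⁻¹ᵀ *ᵥ intCast' g))) ≤ 1 + ε)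
    (τ : Fin k → ℝ) :
    |∑' v : Fin k → ℤ, Real.exp (-Real.pi *
        ((C *ᵥ (intCast' v + τ)) ⬝ᵥ (C *ᵥ (intCast' v + τ)))) - |C.det|⁻¹| ≤ |C.det|⁻¹ * ε := by
  have hC' : IsUnit (C⁻¹ᵀ).det := by
    rw [Matrix.det_transpose]
    exact Matrix.isUnit_nonsing_inv_det _ hC
  have hP := hasSum_poisson_gaussian hC τ
  have hD := (summable_gaussian_int_zero hC').hasSum.mul_left |C.det|⁻¹
  have hz : intCast' (0 : Fin k → ℤ) = 0 := by funext i; simp [intCast']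
  have hδ := hasSum_ite_eq (0 : Fin k → ℤ) |C.det|⁻¹
  have hK : 0 ≤ |C.det|⁻¹ := by positivity
  have hup := hasSum_le (fun g => ?_) (hP.sub hδ) (hD.sub hδ)
  have hlo := hasSum_le (fun g => ?_) (hδ.sub hD) (hP.sub hδ)
  · have := mul_le_mul_of_nonneg_left hε hK
    rw [abs_le]
    constructor <;> linarith
  · rcases eq_or_ne g 0 with rfl | hg
    · simp [hz]
    · simp only [if_neg hg, zero_sub, sub_zero]
      nlinarith [Real.neg_one_le_cos (2 * Real.pi * (intCast' g ⬝ᵥ τ)), mul_nonneg hK (Real.exp_pos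
        (-Real.pi * ((C⁻¹ᵀ *ᵥ intCast' g) ⬝ᵥ (C⁻¹ᵀ *ᵥ intCast' g)))).le]
  · refine sub_le_sub_right ?_ _
    nlinarith [Real.cos_le_one (2 * Real.pi * (intCast' g ⬝ᵥ τ)), mul_nonneg hK (Real.exp_pos
        (-Real.pi * ((C⁻¹ᵀ *ᵥ intCast' g) ⬝ᵥ (C⁻¹ᵀ *ᵥ intCast' g)))).le]

theorem mulVec_dotProduct_eq {k l : ℕ} (A : Matrix (Fin k) (Fin l) ℝ) (x : Fin l → ℝ)
    (y : Fin k → ℝ) : (A *ᵥ x) ⬝ᵥ y = x ⬝ᵥ (Aᵀ *ᵥ y) := by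
  rw [Matrix.dotProduct_mulVec, Matrix.vecMul_transpose]

theorem dotProduct_inv_transpose_mul_self {m : ℕ} (R : Matrix (Fin m) (Fin m) ℝ)
    (x : Fin m → ℝ) : x ⬝ᵥ ((Rᵀ * R)⁻¹ *ᵥ x) = (R⁻¹ᵀ *ᵥ x) ⬝ᵥ (R⁻¹ᵀ *ᵥ x) := by
  rw [mulVec_dotProduct_eq, Matrix.transpose_transpose, Matrix.mulVec_mulVec, Matrix.mul_inv_rev,
    Matrix.transpose_nonsing_inv]

theorem rho_eq_exp {m : ℕ} (R : Matrix (Fin m) (Fin m) ℝ) (x : Fin m → ℝ) :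
    rho R x = Real.exp (-Real.pi * ((R⁻¹ᵀ *ᵥ x) ⬝ᵥ (R⁻¹ᵀ *ᵥ x))) := by
  rw [rho, dotProduct_inv_transpose_mul_self]

theorem posDef_transpose_mul_self {l k : ℕ} {D : Matrix (Fin l) (Fin k) ℝ}
    {L : Matrix (Fin k) (Fin l) ℝ} (h : L * D = 1) : (Dᵀ * D).PosDef := by
  have := Matrix.PosDef.conjTranspose_mul_self D (Function.LeftInverse.injective
    (g := fun y => L *ᵥ y) fun x => by
      simp only [Matrix.mulVec_mulVec, h, Matrix.one_mulVec])
  rwa [Matrix.conjTranspose_eq_transpose_of_trivial] at this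

open scoped MatrixOrder Matrix.Norms.L2Operator in
/-- A square matrix with the same Gram matrix as a given injective matrix. -/
theorem exists_square_gram_eq {l k : ℕ} {D : Matrix (Fin l) (Fin k) ℝ}
    {L : Matrix (Fin k) (Fin l) ℝ} (h : L * D = 1) :
    ∃ C : Matrix (Fin k) (Fin k) ℝ, IsUnit C.det ∧ Cᵀ * C = Dᵀ * D := by
  have hp := posDef_transpose_mul_self h
  obtain ⟨C, hC⟩ := CStarAlgebra.nonneg_iff_eq_star_mul_self.mp hp.posSemidef.nonneg
  rw [Matrix.star_eq_conjTranspose, Matrix.conjTranspose_eq_transpose_of_trivial] at hC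
  refine ⟨C, ?_, hC.symm⟩
  have h1 := hp.det_pos
  rw [hC, Matrix.det_mul] at h1
  exact isUnit_iff_ne_zero.2 fun h0 => by simp [h0] at h1

section Decomposition

variable {n m k : ℕ} {X : Matrix (Fin n) (Fin m) ℝ} {M : Matrix (Fin m) (Fin k) ℝ}
  {P : Matrix (Fin k) (Fin m) ℝ} {B : Matrix (Fin m) (Fin n) ℝ} {R : Matrix (Fin m) (Fin m) ℝ}
  {C : Matrix (Fin k) (Fin k) ℝ}

theorem left_inverse_mul_transpose (hR : IsUnit R.det) (hXB : X * B = 1) :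
    (Bᵀ * R⁻¹) * (R * Xᵀ) = 1 := by
  rw [Matrix.mul_assoc, ← Matrix.mul_assoc R⁻¹, Matrix.nonsing_inv_mul _ hR, Matrix.one_mul,
    ← Matrix.transpose_mul, hXB, Matrix.transpose_one]

theorem left_inverse_inv_transpose_mul (hR : IsUnit R.det) (hPM : P * M = 1) :
    (P * Rᵀ) * (R⁻¹ᵀ * M) = 1 := by
  rw [Matrix.mul_assoc, ← Matrix.mul_assoc Rᵀ, ← Matrix.transpose_mul,
    Matrix.nonsing_inv_mul _ hR, Matrix.transpose_one, Matrix.one_mul, hPM]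

/-- Orthogonal splitting of the quadratic form `x ↦ xᵀ(RᵀR)⁻¹x` along `X` and its kernel. -/
theorem quadratic_form_split (hR : IsUnit R.det) (hXB : X * B = 1) (hXM : X * M = 0)
    (hBM : B * X + M * P = 1)
    (hC : Cᵀ * C = (R⁻¹ᵀ * M)ᵀ * (R⁻¹ᵀ * M)) (x : Fin m → ℝ) (z : Fin n → ℝ) (hx : X *ᵥ x = z) :
    (R⁻¹ᵀ *ᵥ x) ⬝ᵥ (R⁻¹ᵀ *ᵥ x) =
      z ⬝ᵥ (((R * Xᵀ)ᵀ * (R * Xᵀ))⁻¹ *ᵥ z) +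
      (C *ᵥ (P *ᵥ (x - (Rᵀ * (R * Xᵀ)) *ᵥ (((R * Xᵀ)ᵀ * (R * Xᵀ))⁻¹ *ᵥ z)))) ⬝ᵥ
      (C *ᵥ (P *ᵥ (x - (Rᵀ * (R * Xᵀ)) *ᵥ (((R * Xᵀ)ᵀ * (R * Xᵀ))⁻¹ *ᵥ z)))) := by
  set N := (R * Xᵀ)ᵀ * (R * Xᵀ) with hN
  have hNu : IsUnit N.det :=
    isUnit_iff_ne_zero.2 (posDef_transpose_mul_self (left_inverse_mul_transpose hR hXB)).det_pos.ne'
  set q := N⁻¹ *ᵥ z with hq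
  have hNq : N *ᵥ q = z := by
    rw [hq, Matrix.mulVec_mulVec, Matrix.mul_nonsing_inv _ hNu, Matrix.one_mulVec]
  set y := (Rᵀ * (R * Xᵀ)) *ᵥ q with hy
  set s := P *ᵥ (x - y) with hs
  have hXy : X *ᵥ y = z := by
    rw [← hNq, hy, Matrix.mulVec_mulVec, hN, Matrix.transpose_mul, Matrix.transpose_transpose,
      Matrix.mul_assoc]
  have hMs : M *ᵥ s = x - y := by
    rw [hs, Matrix.mulVec_mulVec, eq_sub_of_add_eq' hBM, Matrix.sub_mulVec, Matrix.one_mulVec,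
      ← Matrix.mulVec_mulVec, Matrix.mulVec_sub, hx, hXy, sub_self, Matrix.mulVec_zero, sub_zero]
  have hx' : x = y + M *ᵥ s := by rw [hMs]; abel
  have hWy : R⁻¹ᵀ *ᵥ y = (R * Xᵀ) *ᵥ q := by
    rw [hy, Matrix.mulVec_mulVec, ← Matrix.mul_assoc, ← Matrix.transpose_mul,
      Matrix.mul_nonsing_inv _ hR, Matrix.transpose_one, Matrix.one_mul]
  have hcross : (R⁻¹ᵀ *ᵥ y) ⬝ᵥ (R⁻¹ᵀ *ᵥ (M *ᵥ s)) = 0 := by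
    rw [hWy, mulVec_dotProduct_eq, Matrix.transpose_mul, Matrix.transpose_transpose,
      Matrix.mulVec_mulVec, Matrix.mulVec_mulVec]
    rw [show X * Rᵀ * R⁻¹ᵀ * M = 0 by
      rw [Matrix.mul_assoc, Matrix.mul_assoc, ← Matrix.mul_assoc Rᵀ, ← Matrix.transpose_mul,
        Matrix.nonsing_inv_mul _ hR, Matrix.transpose_one, Matrix.one_mul, hXM]]
    simp
  have h1 : (R⁻¹ᵀ *ᵥ y) ⬝ᵥ (R⁻¹ᵀ *ᵥ y) = z ⬝ᵥ q := by
    rw [hWy, mulVec_dotProduct_eq, Matrix.mulVec_mulVec, ← hN, hNq, dotProduct_comm]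
  have h2 : (R⁻¹ᵀ *ᵥ (M *ᵥ s)) ⬝ᵥ (R⁻¹ᵀ *ᵥ (M *ᵥ s)) = (C *ᵥ s) ⬝ᵥ (C *ᵥ s) := by
    rw [Matrix.mulVec_mulVec, mulVec_dotProduct_eq, Matrix.mulVec_mulVec, ← hC,
      ← Matrix.mulVec_mulVec, ← mulVec_dotProduct_eq]
  have hcross' : (R⁻¹ᵀ *ᵥ (M *ᵥ s)) ⬝ᵥ (R⁻¹ᵀ *ᵥ y) = 0 := by rw [dotProduct_comm, hcross]
  conv_lhs => rw [hx', Matrix.mulVec_add, dotProduct_add, add_dotProduct, add_dotProduct,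
    hcross, hcross', h1, h2]
  ring

/-- The dual Gaussian exponent on the kernel lattice, expressed through a vector of `ℝ^m`. -/
theorem dual_quadratic_form (hR : IsUnit R.det)
    (hC : Cᵀ * C = (R⁻¹ᵀ * M)ᵀ * (R⁻¹ᵀ * M)) (hCu : IsUnit C.det) (g : Fin k → ℝ) :
    Mᵀ *ᵥ ((R⁻¹ * (R⁻¹ᵀ * M)) *ᵥ ((Cᵀ * C)⁻¹ *ᵥ g)) = g ∧
    (C⁻¹ᵀ *ᵥ g) ⬝ᵥ (C⁻¹ᵀ *ᵥ g) =
      (R *ᵥ ((R⁻¹ * (R⁻¹ᵀ * M)) *ᵥ ((Cᵀ * C)⁻¹ *ᵥ g))) ⬝ᵥ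
      (R *ᵥ ((R⁻¹ * (R⁻¹ᵀ * M)) *ᵥ ((Cᵀ * C)⁻¹ *ᵥ g))) := by
  have hu : IsUnit (Cᵀ * C).det := by
    rw [Matrix.det_mul, Matrix.det_transpose]
    exact hCu.mul hCu
  set q := (Cᵀ * C)⁻¹ *ᵥ g with hq
  have hAq : (Cᵀ * C) *ᵥ q = g := by
    rw [hq, Matrix.mulVec_mulVec, Matrix.mul_nonsing_inv _ hu, Matrix.one_mulVec]
  constructor
  · conv_rhs => rw [← hAq, hC]
    rw [Matrix.mulVec_mulVec, Matrix.transpose_mul, Matrix.transpose_transpose, Matrix.mul_assoc]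
  · have h1 : R *ᵥ ((R⁻¹ * (R⁻¹ᵀ * M)) *ᵥ q) = (R⁻¹ᵀ * M) *ᵥ q := by
      rw [Matrix.mulVec_mulVec, ← Matrix.mul_assoc, Matrix.mul_nonsing_inv _ hR, Matrix.one_mul]
    rw [h1, mulVec_dotProduct_eq (R⁻¹ᵀ * M), Matrix.mulVec_mulVec, ← hC, hAq,
      ← dotProduct_inv_transpose_mul_self, ← hq, dotProduct_comm]

end Decomposition

theorem intCast'_mulVec {k l : ℕ} (A : Matrix (Fin k) (Fin l) ℤ) (v : Fin l → ℤ) :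
    intCast' (A *ᵥ v) = A.map (Int.cast : ℤ → ℝ) *ᵥ intCast' v := by
  funext i
  simp [intCast', Matrix.mulVec, dotProduct]

theorem map_intCast_mul {k l p : ℕ} (A : Matrix (Fin k) (Fin l) ℤ) (B : Matrix (Fin l) (Fin p) ℤ) :
    (A * B).map (Int.cast : ℤ → ℝ) = A.map (Int.cast : ℤ → ℝ) * B.map (Int.cast : ℤ → ℝ) :=
  Matrix.map_mul (f := Int.castRingHom ℝ)

theorem map_intCast_one {k : ℕ} :
    (1 : Matrix (Fin k) (Fin k) ℤ).map (Int.cast : ℤ → ℝ) = 1 :=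
  Matrix.map_one _ Int.cast_zero Int.cast_one

theorem map_intCast_add {k l : ℕ} (A B : Matrix (Fin k) (Fin l) ℤ) :
    (A + B).map (Int.cast : ℤ → ℝ) = A.map (Int.cast : ℤ → ℝ) + B.map (Int.cast : ℤ → ℝ) :=
  Matrix.map_add _ Int.cast_add A B

theorem intCast'_injective {k : ℕ} : Function.Injective (intCast' : (Fin k → ℤ) → Fin k → ℝ) := by
  intro v w h
  funext i
  have := congrFun h i
  simpa [intCast'] using this

theorem summable_rho {m : ℕ} {R : Matrix (Fin m) (Fin m) ℝ} (hR : IsUnit R.det) (c : Fin m → ℝ) :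
    Summable fun v : Fin m → ℤ => rho R (intCast' v + c) := by
  have h : IsUnit (R⁻¹ᵀ).det := by
    rw [Matrix.det_transpose]
    exact Matrix.isUnit_nonsing_inv_det _ hR
  simpa only [rho_eq_exp] using summable_gaussian_int h c

theorem tsum_rho_pos {l n : ℕ} {D : Matrix (Fin l) (Fin n) ℝ} {z : Fin n → ℝ}
    (h : Summable fun w : Fin n → ℤ => rho D (intCast' w + z)) :
    0 < ∑' w : Fin n → ℤ, rho D (intCast' w + z) :=
  h.tsum_pos (fun _ => (Real.exp_pos _).le) 0 (Real.exp_pos _)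

theorem summable_rho_of_left_inverse {l n : ℕ} {D : Matrix (Fin l) (Fin n) ℝ}
    {L : Matrix (Fin n) (Fin l) ℝ} (h : L * D = 1) (z : Fin n → ℝ) :
    Summable fun w : Fin n → ℤ => rho D (intCast' w + z) := by
  obtain ⟨C, hC, hCD⟩ := exists_square_gram_eq h
  have := summable_rho hC z
  simpa only [rho, hCD] using this

section Splitting

variable {n m k : ℕ} {X : Matrix (Fin n) (Fin m) ℤ} {M : Matrix (Fin m) (Fin k) ℤ}
  {P : Matrix (Fin k) (Fin m) ℤ} {B : Matrix (Fin m) (Fin n) ℤ}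

/-- The coordinates on `ℤ^m` given by an integral splitting of `X`. -/
def splittingEquiv (hXB : X * B = 1) (hXM : X * M = 0) (hPM : P * M = 1)
    (hBM : B * X + M * P = 1) : (Fin n → ℤ) × (Fin k → ℤ) ≃ (Fin m → ℤ) where
  toFun p := B *ᵥ p.1 + M *ᵥ p.2
  invFun v := (X *ᵥ v, P *ᵥ v)
  left_inv p := by
    have hPB : P * B = 0 := by
      have h : B * X * B + M * P * B = B := by rw [← Matrix.add_mul, hBM, Matrix.one_mul]
      rw [Matrix.mul_assoc, hXB, Matrix.mul_one, add_eq_left] at h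
      calc P * B = P * M * P * B := by rw [hPM, Matrix.one_mul]
        _ = P * (M * P * B) := by simp only [Matrix.mul_assoc]
        _ = 0 := by rw [h, Matrix.mul_zero]
    ext1
    · simp only [Matrix.mulVec_add, Matrix.mulVec_mulVec, hXB, hXM]
      simp
    · simp only [Matrix.mulVec_add, Matrix.mulVec_mulVec, hPB, hPM]
      simp
  right_inv v := by
    simp only [Matrix.mulVec_mulVec, ← Matrix.add_mulVec, hBM, Matrix.one_mulVec]

/-- The pushforward of a Gaussian along `X` is a Gaussian reweighted by Gaussian sums over
translates of `ℤ^k`. -/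
theorem exists_Edist_eq {R : Matrix (Fin m) (Fin m) ℝ} (hR : IsUnit R.det)
    {C : Matrix (Fin k) (Fin k) ℝ}
    (hXB : X * B = 1) (hXM : X * M = 0) (hPM : P * M = 1) (hBM : B * X + M * P = 1)
    (hC : Cᵀ * C = (R⁻¹ᵀ * M.map (Int.cast : ℤ → ℝ))ᵀ * (R⁻¹ᵀ * M.map (Int.cast : ℤ → ℝ)))
    (c : Fin m → ℝ) :
    ∃ τ : (Fin n → ℤ) → (Fin k → ℝ), ∀ w : Fin n → ℤ,
      Edist (X.map (Int.cast : ℤ → ℝ)) R c (intCast' w + X.map (Int.cast : ℤ → ℝ) *ᵥ c) =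
        rho (R * (X.map (Int.cast : ℤ → ℝ))ᵀ) (intCast' w + X.map (Int.cast : ℤ → ℝ) *ᵥ c) *
          (∑' u : Fin k → ℤ, Real.exp (-Real.pi *
            ((C *ᵥ (intCast' u + τ w)) ⬝ᵥ (C *ᵥ (intCast' u + τ w))))) /
        ∑' w' : Fin n → ℤ,
          rho (R * (X.map (Int.cast : ℤ → ℝ))ᵀ) (intCast' w' + X.map (Int.cast : ℤ → ℝ) *ᵥ c) *
          (∑' u : Fin k → ℤ, Real.exp (-Real.pi *
            ((C *ᵥ (intCast' u + τ w')) ⬝ᵥ (C *ᵥ (intCast' u + τ w'))))) := by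
  set Xr := X.map (Int.cast : ℤ → ℝ) with hXr
  set Mr := M.map (Int.cast : ℤ → ℝ) with hMr
  set Pr := P.map (Int.cast : ℤ → ℝ) with hPr
  set Br := B.map (Int.cast : ℤ → ℝ) with hBr
  have hXBr : Xr * Br = 1 := by rw [hXr, hBr, ← map_intCast_mul, hXB, map_intCast_one]
  have hXMr : Xr * Mr = 0 := by
    rw [hXr, hMr, ← map_intCast_mul, hXM]
    exact Matrix.map_zero _ Int.cast_zero
  have hPMr : Pr * Mr = 1 := by rw [hPr, hMr, ← map_intCast_mul, hPM, map_intCast_one]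
  have hBMr : Br * Xr + Mr * Pr = 1 := by
    rw [hPr, hMr, hBr, hXr, ← map_intCast_mul, ← map_intCast_mul, ← map_intCast_add, hBM,
      map_intCast_one]
  set z : (Fin n → ℤ) → Fin n → ℝ := fun w => intCast' w + Xr *ᵥ c with hz
  set τ : (Fin n → ℤ) → Fin k → ℝ := fun w => Pr *ᵥ (Br *ᵥ intCast' w + c -
    (Rᵀ * (R * Xrᵀ)) *ᵥ (((R * Xrᵀ)ᵀ * (R * Xrᵀ))⁻¹ *ᵥ z w)) with hτ
  refine ⟨τ, ?_⟩
  set e : (Fin n → ℤ) → (Fin k → ℤ) → ℝ := fun w u => Real.exp (-Real.pi *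
            ((C *ᵥ (intCast' u + τ w)) ⬝ᵥ (C *ᵥ (intCast' u + τ w)))) with he
  set Φ := splittingEquiv hXB hXM hPM hBM with hΦ
  have hΦc : ∀ w u, intCast' (Φ (w, u)) = Br *ᵥ intCast' w + Mr *ᵥ intCast' u := by
    intro w u
    change intCast' (B *ᵥ w + M *ᵥ u) = _
    rw [intCast'_add, intCast'_mulVec, intCast'_mulVec]
  have hXΦ : ∀ w u, Xr *ᵥ (intCast' (Φ (w, u)) + c) = z w := by
    intro w u
    rw [hΦc, Matrix.mulVec_add, Matrix.mulVec_add, Matrix.mulVec_mulVec, Matrix.mulVec_mulVec,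
      hXBr, hXMr, Matrix.one_mulVec, Matrix.zero_mulVec, add_zero]
  have hkey : ∀ w u, rho R (intCast' (Φ (w, u)) + c) = rho (R * Xrᵀ) (z w) * e w u := by
    intro w u
    rw [rho_eq_exp, quadratic_form_split hR hXBr hXMr hBMr hC _ _ (hXΦ w u), mul_add, Real.exp_add]
    simp only [he, rho]
    have : Pr *ᵥ (intCast' (Φ (w, u)) + c -
        (Rᵀ * (R * Xrᵀ)) *ᵥ (((R * Xrᵀ)ᵀ * (R * Xrᵀ))⁻¹ *ᵥ z w)) = intCast' u + τ w := by
      rw [hτ, hΦc, show Br *ᵥ intCast' w + Mr *ᵥ intCast' u + c -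
        (Rᵀ * (R * Xrᵀ)) *ᵥ (((R * Xrᵀ)ᵀ * (R * Xrᵀ))⁻¹ *ᵥ z w) = Mr *ᵥ intCast' u +
        (Br *ᵥ intCast' w + c - (Rᵀ * (R * Xrᵀ)) *ᵥ (((R * Xrᵀ)ᵀ * (R * Xrᵀ))⁻¹ *ᵥ z w)) by abel,
        Matrix.mulVec_add, Matrix.mulVec_mulVec, hPMr, Matrix.one_mulVec]
    rw [this]
  have hsum := summable_rho hR c
  have hsumΦ : Summable fun p : (Fin n → ℤ) × (Fin k → ℤ) => rho (R * Xrᵀ) (z p.1) * e p.1 p.2 := by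
    refine (Φ.summable_iff.2 hsum).congr fun p => ?_
    exact hkey p.1 p.2
  intro w
  change Edist Xr R c (z w) = rho (R * Xrᵀ) (z w) * (∑' u, e w u) /
    ∑' w', rho (R * Xrᵀ) (z w') * (∑' u, e w' u)
  rw [Edist]
  congr 1
  · rw [← Φ.tsum_eq]
    have h1 : ∀ p : (Fin n → ℤ) × (Fin k → ℤ),
        (if Xr *ᵥ (intCast' (Φ p) + c) = z w then rho R (intCast' (Φ p) + c) else 0) =
        if p.1 = w then rho (R * Xrᵀ) (z p.1) * e p.1 p.2 else 0 := by
      rintro ⟨w', u⟩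
      rw [hXΦ, hkey]
      have : z w' = z w ↔ w' = w :=
        ⟨fun h => intCast'_injective (add_right_cancel h), fun h => by rw [h]⟩
      simp only [this]
    rw [tsum_congr h1]
    have h2 : Summable fun p : (Fin n → ℤ) × (Fin k → ℤ) =>
        if p.1 = w then rho (R * Xrᵀ) (z p.1) * e p.1 p.2 else 0 :=
      hsumΦ.of_nonneg_of_le (fun p => by
        split_ifs
        exacts [mul_nonneg (Real.exp_pos _).le (Real.exp_pos _).le, le_rfl]) fun p => by
        split_ifs
        exacts [le_rfl, mul_nonneg (Real.exp_pos _).le (Real.exp_pos _).le]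
    rw [h2.tsum_prod, tsum_eq_single w fun w' hw' => by simp [hw']]
    simp [tsum_mul_left]
  · rw [← Φ.tsum_eq, tsum_congr fun p : (Fin n → ℤ) × (Fin k → ℤ) => hkey p.1 p.2,
      hsumΦ.tsum_prod]
    refine tsum_congr fun w' => ?_
    simp only [tsum_mul_left]

theorem abs_half_le_of_floor (x : ℝ) : |(⌊x + 1 / 2⌋ : ℝ)| / 2 ≤ |x| := by
  have h1 := Int.floor_le (x + 1 / 2)
  have h2 := Int.lt_floor_add_one (x + 1 / 2)
  rcases lt_trichotomy ⌊x + 1 / 2⌋ 0 with h | h | h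
  · have h3 : (⌊x + 1 / 2⌋ : ℝ) ≤ -1 := by exact_mod_cast Int.le_sub_one_of_lt h
    rw [abs_of_neg (by linarith), abs_of_neg (by linarith)]
    linarith
  · rw [h]
    simp
  · have h3 : (1 : ℝ) ≤ (⌊x + 1 / 2⌋ : ℝ) := by exact_mod_cast h
    rw [abs_of_pos (by linarith), abs_of_pos (by linarith)]
    linarith

/-- Bound on the dual Gaussian sum of the kernel lattice. -/
theorem tsum_dual_gaussian_le {R : Matrix (Fin m) (Fin m) ℝ} (hR : IsUnit R.det)
    {C : Matrix (Fin k) (Fin k) ℝ} (hCu : IsUnit C.det) (hXM : X * M = 0) (hPM : P * M = 1)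
    (hBM : B * X + M * P = 1)
    (hC : Cᵀ * C = (R⁻¹ᵀ * M.map (Int.cast : ℤ → ℝ))ᵀ * (R⁻¹ᵀ * M.map (Int.cast : ℤ → ℝ)))
    {d σ : ℝ} (hd : 0 < d) (hσ0 : 0 < σ)
    (hσ : ∀ x : Fin m → ℝ, σ ^ 2 * (x ⬝ᵥ x) ≤ (R *ᵥ x) ⬝ᵥ (R *ᵥ x))
    (hlat : ∀ (u : Fin n → ℝ) (g : Fin m → ℤ),
      (∀ j, |((X.map (Int.cast : ℤ → ℝ))ᵀ *ᵥ u) j - g j| < d) → ∃ w : Fin n → ℤ, Xᵀ *ᵥ w = g) :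
    ∑' g : Fin k → ℤ, Real.exp (-Real.pi * ((C⁻¹ᵀ *ᵥ intCast' g) ⬝ᵥ (C⁻¹ᵀ *ᵥ intCast' g))) ≤
      (∑' a : ℤ, Real.exp (-(Real.pi * σ ^ 2 * d ^ 2 / 4) * (a : ℝ) ^ 2)) ^ m := by
  set Xr := X.map (Int.cast : ℤ → ℝ) with hXr
  set Mr := M.map (Int.cast : ℤ → ℝ) with hMr
  set Pr := P.map (Int.cast : ℤ → ℝ) with hPr
  set Br := B.map (Int.cast : ℤ → ℝ) with hBr
  have hBMr : Br * Xr + Mr * Pr = 1 := by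
    rw [hPr, hMr, hBr, hXr, ← map_intCast_mul, ← map_intCast_mul, ← map_intCast_add, hBM,
      map_intCast_one]
  set r : (Fin k → ℝ) → Fin m → ℝ := fun g =>
    (R⁻¹ * (R⁻¹ᵀ * Mr)) *ᵥ ((Cᵀ * C)⁻¹ *ᵥ g) with hr
  have hMrr : ∀ g, Mrᵀ *ᵥ r g = g := fun g => (dual_quadratic_form hR hC hCu g).1
  have hqf : ∀ g, (C⁻¹ᵀ *ᵥ g) ⬝ᵥ (C⁻¹ᵀ *ᵥ g) = (R *ᵥ r g) ⬝ᵥ (R *ᵥ r g) :=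
    fun g => (dual_quadratic_form hR hC hCu g).2
  have hrsub : ∀ g g', r (g - g') = r g - r g' := fun g g' => by simp [hr, Matrix.mulVec_sub]
  have hsmall : ∀ g : Fin k → ℤ, (∀ j, |r (intCast' g) j| < d) → g = 0 := by
    intro g hg
    have h1 : r (intCast' g) = Xrᵀ *ᵥ (Brᵀ *ᵥ r (intCast' g)) + intCast' (Pᵀ *ᵥ g) := by
      have h2 := congrArg (fun A => Aᵀ *ᵥ r (intCast' g)) hBMr
      simp only [Matrix.transpose_add, Matrix.transpose_mul, Matrix.transpose_one,
        Matrix.one_mulVec, Matrix.add_mulVec, ← Matrix.mulVec_mulVec, hMrr] at h2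
      rw [intCast'_mulVec, ← Matrix.transpose_map]
      exact h2.symm
    obtain ⟨w, hw⟩ := hlat (-(Brᵀ *ᵥ r (intCast' g))) (Pᵀ *ᵥ g) fun j => by
      have h3 := congrFun h1 j
      have h4 := hg j
      rw [Pi.add_apply] at h3
      rw [Matrix.mulVec_neg, Pi.neg_apply, ← abs_neg]
      convert h4 using 2
      rw [h3]
      simp [intCast']
      ring
    calc g = (P * M)ᵀ *ᵥ g := by rw [hPM, Matrix.transpose_one, Matrix.one_mulVec]
      _ = Mᵀ *ᵥ (Pᵀ *ᵥ g) := by rw [Matrix.transpose_mul, Matrix.mulVec_mulVec]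
      _ = (X * M)ᵀ *ᵥ w := by rw [← hw, Matrix.transpose_mul, Matrix.mulVec_mulVec]
      _ = 0 := by rw [hXM, Matrix.transpose_zero, Matrix.zero_mulVec]
  set A : (Fin k → ℤ) → Fin m → ℤ := fun g j => ⌊r (intCast' g) j / d + 1 / 2⌋ with hA
  have hAinj : Function.Injective A := by
    intro g g' h
    rw [← sub_eq_zero]
    refine hsmall _ fun j => ?_
    have h1 : ⌊r (intCast' g) j / d + 1 / 2⌋ = ⌊r (intCast' g') j / d + 1 / 2⌋ := congrFun h j
    have h2 := Int.abs_sub_lt_one_of_floor_eq_floor h1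
    rw [add_sub_add_right_eq_sub, ← sub_div, abs_div, abs_of_pos hd, div_lt_one hd] at h2
    have h3 : intCast' (g - g') = intCast' g - intCast' g' := by
      rw [sub_eq_add_neg, intCast'_add, intCast'_neg, sub_eq_add_neg]
    rwa [h3, hrsub, Pi.sub_apply]
  have hc : 0 < Real.pi * σ ^ 2 * d ^ 2 / 4 := by positivity
  have hprod := hasSum_pi_prod (k := m) (fun _ _ => (Real.exp_pos _).le)
    fun _ => (summable_exp_neg_mul_int_sq hc).hasSum
  have hC' : IsUnit (C⁻¹ᵀ).det := by
    rw [Matrix.det_transpose]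
    exact Matrix.isUnit_nonsing_inv_det _ hCu
  have := Summable.tsum_le_tsum_of_inj A hAinj
    (fun a _ => Finset.prod_nonneg fun i _ => (Real.exp_pos _).le) (fun g => ?_)
    (summable_gaussian_int_zero hC') hprod.summable
  · refine this.trans (le_of_eq ?_)
    rw [hprod.tsum_eq]
    simp
  · rw [← Real.exp_sum, Real.exp_le_exp, hqf, ← Finset.mul_sum]
    have h1 := hσ (r (intCast' g))
    have h2 : d ^ 2 / 4 * ∑ i, (A g i : ℝ) ^ 2 ≤ r (intCast' g) ⬝ᵥ r (intCast' g) := by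
      rw [Finset.mul_sum]
      refine Finset.sum_le_sum fun i _ => ?_
      have h3 := abs_half_le_of_floor (r (intCast' g) i / d)
      rw [abs_div, abs_of_pos hd, le_div_iff₀ hd] at h3
      have h4 := pow_le_pow_left₀ (by positivity) h3 2
      rw [sq_abs, mul_pow, div_pow, sq_abs] at h4
      calc d ^ 2 / 4 * (A g i : ℝ) ^ 2 = (A g i : ℝ) ^ 2 / 2 ^ 2 * d ^ 2 := by ring
        _ ≤ r (intCast' g) i ^ 2 := h4
        _ = _ := sq _
    have h3 := mul_le_mul_of_nonneg_left h2 (sq_nonneg σ)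
    have h4 := mul_le_mul_of_nonneg_left (h3.trans h1) Real.pi_pos.le
    linarith

end Splitting

theorem statDist_le_of_lattice_condition {n m : ℕ} {X : Matrix (Fin n) (Fin m) ℤ}
    {R : Matrix (Fin m) (Fin m) ℝ} (hR : IsUnit R.det) (c : Fin m → ℝ) {d σ ε : ℝ} (hd : 0 < d)
    (hσ0 : 0 < σ) (hσ : ∀ x : Fin m → ℝ, σ ^ 2 * (x ⬝ᵥ x) ≤ (R *ᵥ x) ⬝ᵥ (R *ᵥ x))
    (hε0 : 0 < ε) (hε : ε ≤ 1 / 2)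
    (hinj : ∀ u : Fin n → ℝ, (X.map (Int.cast : ℤ → ℝ))ᵀ *ᵥ u = 0 → u = 0)
    (hlat : ∀ (u : Fin n → ℝ) (g : Fin m → ℤ),
      (∀ j, |((X.map (Int.cast : ℤ → ℝ))ᵀ *ᵥ u) j - g j| < d) → ∃ w : Fin n → ℤ, Xᵀ *ᵥ w = g)
    (hθ : (∑' a : ℤ, Real.exp (-(Real.pi * σ ^ 2 * d ^ 2 / 4) * (a : ℝ) ^ 2)) ^ m ≤ 1 + ε) :
    statDist X R c ≤ 2 * ε := by
  have hcast : ∀ w : Fin n → ℤ, intCast' (Xᵀ *ᵥ w) = (X.map (Int.cast : ℤ → ℝ))ᵀ *ᵥ intCast' w :=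
    fun w => by rw [intCast'_mulVec, Matrix.transpose_map]
  obtain ⟨k, M, P, B, hXB, hXM, hPM, hBM⟩ := exists_integral_splitting X
    (fun w w' h => by
      have h1 : (X.map (Int.cast : ℤ → ℝ))ᵀ *ᵥ (intCast' w - intCast' w') = 0 := by
        rw [Matrix.mulVec_sub, ← hcast, ← hcast, sub_eq_zero]
        exact congrArg intCast' h
      exact intCast'_injective (sub_eq_zero.1 (hinj _ h1)))
    (fun r g w hr h => by
      refine hlat ((r : ℝ)⁻¹ • intCast' w) g fun j => ?_
      have hr' : (r : ℝ) ≠ 0 := by exact_mod_cast hr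
      have h1 : (r : ℝ) * g j = ((X.map (Int.cast : ℤ → ℝ))ᵀ *ᵥ intCast' w) j := by
        rw [← hcast, h]
        simp [intCast']
      rw [Matrix.mulVec_smul, Pi.smul_apply, ← h1, smul_eq_mul, inv_mul_cancel_left₀ hr']
      simpa using hd)
  have hPMr : P.map (Int.cast : ℤ → ℝ) * M.map (Int.cast : ℤ → ℝ) = 1 := by
    rw [← map_intCast_mul, hPM, map_intCast_one]
  have hXBr : X.map (Int.cast : ℤ → ℝ) * B.map (Int.cast : ℤ → ℝ) = 1 := by
    rw [← map_intCast_mul, hXB, map_intCast_one]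
  obtain ⟨C, hCu, hC⟩ := exists_square_gram_eq (left_inverse_inv_transpose_mul hR hPMr)
  have hdual := (tsum_dual_gaussian_le hR hCu hXM hPM hBM hC hd hσ0 hσ hlat).trans hθ
  obtain ⟨τ, hτ⟩ := exists_Edist_eq hR hXB hXM hPM hBM hC c
  have hs := summable_rho_of_left_inverse (left_inverse_mul_transpose hR hXBr)
    (X.map (Int.cast : ℤ → ℝ) *ᵥ c)
  rw [statDist]
  simp only [hτ]
  exact half_tsum_abs_sub_le (fun _ => (Real.exp_pos _).le) hs (tsum_rho_pos hs)
    (inv_pos.2 (abs_pos.2 hCu.ne_zero)) hε0 hε fun w => abs_tsum_gaussian_sub_le hCu hdual (τ w)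

section Columns

variable {n m : ℕ} {y : Fin m → Fin n → ℤ} {r : ℝ} {q : ℕ}

theorem exists_int_vector_near (hr : 1 < r) (hq : 16 * r ^ 2 ≤ q)
    (hy : ∀ j (v : Fin n → ℝ) (b : ℝ), 0 ≤ b → (∀ i, |v i| ≤ b) → |intCast' (y j) ⬝ᵥ v| ≤ r * b)
    (hsep : ∀ a : Fin n → Fin q, (∃ l, ∀ k : ℤ, 1 / (4 * r) ≤ |(a l : ℝ) / q - k|) →
      ∃ j, ¬ ∃ k : ℤ, |intCast' (y j) ⬝ᵥ (fun l => (a l : ℝ) / q) - k| < 1 / (8 * r))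
    {u : Fin n → ℝ} (hu : ∀ j, ∃ k : ℤ, |intCast' (y j) ⬝ᵥ u - k| < 1 / (16 * r)) :
    ∃ w : Fin n → ℤ, ∀ l, |u l - w l| ≤ 1 / (2 * r) := by
  have hr0 : 0 < r := by linarith
  have hq0 : (0 : ℝ) < q := lt_of_lt_of_le (by positivity) hq
  have hfl : ∀ l, 0 ≤ (q : ℝ) * Int.fract (u l) := fun l => mul_nonneg hq0.le (Int.fract_nonneg _)
  set a : Fin n → Fin q := fun l => ⟨⌊(q : ℝ) * Int.fract (u l)⌋₊, by
    rw [Nat.floor_lt (hfl l)]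
    exact mul_lt_of_lt_one_right hq0 (Int.fract_lt_one _)⟩ with ha
  have herr : ∀ l, |Int.fract (u l) - (a l : ℝ) / q| ≤ 1 / q := by
    intro l
    have h1 := Nat.floor_le (hfl l)
    have h2 := Nat.lt_floor_add_one ((q : ℝ) * Int.fract (u l))
    have h3 : Int.fract (u l) - (a l : ℝ) / q =
        ((q : ℝ) * Int.fract (u l) - (⌊(q : ℝ) * Int.fract (u l)⌋₊ : ℝ)) / q := by
      rw [ha]
      field_simp
    rw [h3, abs_div, abs_of_pos hq0, abs_of_nonneg (by linarith)]
    gcongr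
    linarith
  have hrq : r * (1 / q) ≤ 1 / (16 * r) := by
    rw [mul_one_div, div_le_div_iff₀ hq0 (by positivity)]
    linarith
  have hnear : ∀ j, ∃ k : ℤ, |intCast' (y j) ⬝ᵥ (fun l => (a l : ℝ) / q) - k| < 1 / (8 * r) := by
    intro j
    obtain ⟨k, hk⟩ := hu j
    refine ⟨k - y j ⬝ᵥ (fun l => ⌊u l⌋), ?_⟩
    have h1 := hy j (fun l => Int.fract (u l) - (a l : ℝ) / q) (1 / q) (by positivity) herr
    have h2 : intCast' (y j) ⬝ᵥ (fun l => (a l : ℝ) / q) -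
        ((k - y j ⬝ᵥ (fun l => ⌊u l⌋) : ℤ) : ℝ) = (intCast' (y j) ⬝ᵥ u - k) -
        intCast' (y j) ⬝ᵥ (fun l => Int.fract (u l) - (a l : ℝ) / q) := by
      have h3 : intCast' (y j) ⬝ᵥ u = ((y j ⬝ᵥ (fun l => ⌊u l⌋) : ℤ) : ℝ) +
          intCast' (y j) ⬝ᵥ (fun l => Int.fract (u l) - (a l : ℝ) / q) +
          intCast' (y j) ⬝ᵥ (fun l => (a l : ℝ) / q) := by
        simp only [dotProduct, intCast', Int.cast_sum, Int.cast_mul, ← Finset.sum_add_distrib]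
        refine Finset.sum_congr rfl fun l _ => ?_
        rw [← mul_add, ← mul_add, add_assoc, sub_add_cancel, Int.floor_add_fract]
      rw [h3]
      push_cast
      ring
    rw [h2]
    calc _ ≤ _ := abs_sub _ _
      _ < 1 / (16 * r) + 1 / (16 * r) := add_lt_add_of_lt_of_le hk (h1.trans hrq)
      _ = 1 / (8 * r) := by field_simp; norm_num
  have hall : ∀ l, ∃ k : ℤ, |(a l : ℝ) / q - k| < 1 / (4 * r) := by
    by_contra! h
    obtain ⟨j, hj⟩ := hsep a h
    exact hj (hnear j)
  choose k hk using hall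
  refine ⟨fun l => ⌊u l⌋ + k l, fun l => ?_⟩
  have h1 : u l - ((⌊u l⌋ + k l : ℤ) : ℝ) =
      (Int.fract (u l) - (a l : ℝ) / q) + ((a l : ℝ) / q - k l) := by
    rw [Int.fract]
    push_cast
    ring
  have h2 : 1 / (q : ℝ) ≤ 1 / (16 * r) := by
    refine one_div_le_one_div_of_le (by positivity) (le_trans ?_ hq)
    nlinarith
  rw [h1]
  calc _ ≤ _ := abs_add_le _ _
    _ ≤ 1 / (16 * r) + 1 / (4 * r) := add_le_add ((herr l).trans h2) (hk l).le
    _ ≤ 1 / (2 * r) := by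
      rw [← sub_nonneg]
      have : 1 / (2 * r) - (1 / (16 * r) + 1 / (4 * r)) = 3 / (16 * r) := by field_simp; norm_num
      rw [this]
      positivity

theorem exists_int_vector_dotProduct_eq (hr : 1 < r) (hq : 16 * r ^ 2 ≤ q)
    (hy : ∀ j (v : Fin n → ℝ) (b : ℝ), 0 ≤ b → (∀ i, |v i| ≤ b) → |intCast' (y j) ⬝ᵥ v| ≤ r * b)
    (hsep : ∀ a : Fin n → Fin q, (∃ l, ∀ k : ℤ, 1 / (4 * r) ≤ |(a l : ℝ) / q - k|) →
      ∃ j, ¬ ∃ k : ℤ, |intCast' (y j) ⬝ᵥ (fun l => (a l : ℝ) / q) - k| < 1 / (8 * r))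
    {u : Fin n → ℝ} {g : Fin m → ℤ} (hu : ∀ j, |intCast' (y j) ⬝ᵥ u - g j| < 1 / (16 * r)) :
    ∃ w : Fin n → ℤ, ∀ j, y j ⬝ᵥ w = g j := by
  have hr0 : 0 < r := by linarith
  obtain ⟨w, hw⟩ := exists_int_vector_near hr hq hy hsep fun j => ⟨g j, hu j⟩
  refine ⟨w, fun j => ?_⟩
  have h1 := hy j (fun l => u l - w l) _ (by positivity) hw
  have h2 : intCast' (y j) ⬝ᵥ (fun l => u l - w l) =
      intCast' (y j) ⬝ᵥ u - ((y j ⬝ᵥ w : ℤ) : ℝ) := by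
    simp only [dotProduct, intCast', Int.cast_sum, Int.cast_mul, ← Finset.sum_sub_distrib, mul_sub]
  rw [h2, show r * (1 / (2 * r)) = 1 / 2 by field_simp] at h1
  have h3 : |((y j ⬝ᵥ w - g j : ℤ) : ℝ)| < 1 := by
    rw [show ((y j ⬝ᵥ w - g j : ℤ) : ℝ) = (intCast' (y j) ⬝ᵥ u - g j) -
      (intCast' (y j) ⬝ᵥ u - ((y j ⬝ᵥ w : ℤ) : ℝ)) by push_cast; ring]
    calc _ ≤ _ := abs_sub _ _
      _ < 1 / (16 * r) + 1 / 2 := add_lt_add_of_lt_of_le (hu j) h1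
      _ ≤ 1 / 16 + 1 / 2 := by
        gcongr
        linarith
      _ ≤ 1 := by norm_num
  rw [← Int.cast_abs] at h3
  have h4 : |y j ⬝ᵥ w - g j| < 1 := by exact_mod_cast h3
  exact sub_eq_zero.1 (Int.abs_lt_one_iff.1 h4)

theorem eq_zero_of_forall_dotProduct_eq_zero (hr : 1 < r) (hq : 16 * r ^ 2 ≤ q)
    (hy : ∀ j (v : Fin n → ℝ) (b : ℝ), 0 ≤ b → (∀ i, |v i| ≤ b) → |intCast' (y j) ⬝ᵥ v| ≤ r * b)
    (hsep : ∀ a : Fin n → Fin q, (∃ l, ∀ k : ℤ, 1 / (4 * r) ≤ |(a l : ℝ) / q - k|) →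
      ∃ j, ¬ ∃ k : ℤ, |intCast' (y j) ⬝ᵥ (fun l => (a l : ℝ) / q) - k| < 1 / (8 * r))
    {u : Fin n → ℝ} (hu : ∀ j, intCast' (y j) ⬝ᵥ u = 0) : u = 0 := by
  have hr0 : 0 < r := by linarith
  by_contra hne
  obtain ⟨l, hl⟩ := Function.ne_iff.1 hne
  rw [Pi.zero_apply] at hl
  obtain ⟨w, hw⟩ := exists_int_vector_near (u := (2 * u l)⁻¹ • u) hr hq hy hsep fun j =>
    ⟨0, by rw [dotProduct_smul, hu j]; simpa using hr0⟩
  have h1 := hw l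
  rw [Pi.smul_apply, smul_eq_mul, show (2 * u l)⁻¹ * u l = 1 / 2 by field_simp] at h1
  have h2 : 1 / (2 * r) < 1 / 2 := by
    rw [div_lt_div_iff₀ (by positivity) (by positivity)]
    linarith
  have h3 := abs_lt.1 (h1.trans_lt h2)
  have h4 : (0 : ℝ) < w l := by linarith
  have h5 : (w l : ℝ) < 1 := by linarith
  have h6 : 0 < w l := by exact_mod_cast h4
  have h7 : w l < 1 := by exact_mod_cast h5
  omega

end Columns

section Singular

variable {n : ℕ} {S : Matrix (Fin n) (Fin n) ℝ}

theorem sq_mul_dotProduct_le_of_enorm'_le {a b : ℝ} {k l : ℕ} {x : Fin k → ℝ} {z : Fin l → ℝ}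
    (ha : 0 ≤ a) (h : a * enorm' x ≤ b * enorm' z) :
    a ^ 2 * (x ⬝ᵥ x) ≤ b ^ 2 * (z ⬝ᵥ z) := by
  have hd : ∀ {p : ℕ} (t : Fin p → ℝ), t ⬝ᵥ t = enorm' t ^ 2 := fun t => by
    rw [enorm', Real.sq_sqrt (Finset.sum_nonneg fun _ _ => sq_nonneg _), dotProduct]
    simp only [sq]
  rw [hd, hd, ← mul_pow, ← mul_pow]
  exact pow_le_pow_left₀ (mul_nonneg ha (Real.sqrt_nonneg _)) h 2

theorem dotProduct_sq_le {k : ℕ} (x z : Fin k → ℝ) : (x ⬝ᵥ z) ^ 2 ≤ (x ⬝ᵥ x) * (z ⬝ᵥ z) := by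
  simpa only [dotProduct, ← sq] using Finset.sum_mul_sq_le_sq_mul_sq Finset.univ x z

theorem dotProduct_self_nonneg' {k : ℕ} (x : Fin k → ℝ) : 0 ≤ x ⬝ᵥ x :=
  Finset.sum_nonneg fun _ _ => mul_self_nonneg _

theorem dotProduct_self_le_sq_mul (hS : IsUnit S.det) {σ : ℝ}
    (hσ : ∀ x, (S *ᵥ x) ⬝ᵥ (S *ᵥ x) ≤ σ ^ 2 * (x ⬝ᵥ x)) (x : Fin n → ℝ) :
    x ⬝ᵥ x ≤ σ ^ 2 * ((S⁻¹ᵀ *ᵥ x) ⬝ᵥ (S⁻¹ᵀ *ᵥ x)) := by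
  have h1 : (S⁻¹ᵀ *ᵥ x) ⬝ᵥ (S *ᵥ x) = x ⬝ᵥ x := by
    rw [mulVec_dotProduct_eq, Matrix.transpose_transpose, Matrix.mulVec_mulVec,
      Matrix.nonsing_inv_mul _ hS, Matrix.one_mulVec]
  have h2 := dotProduct_sq_le (S⁻¹ᵀ *ᵥ x) (S *ᵥ x)
  rw [h1] at h2
  have h3 := dotProduct_self_nonneg' x
  have h4 := dotProduct_self_nonneg' (S⁻¹ᵀ *ᵥ x)
  rcases h3.eq_or_lt with h | h
  · rw [← h]
    positivity
  · have h5 := mul_le_mul_of_nonneg_left (hσ x) h4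
    refine le_of_mul_le_mul_right ?_ h
    nlinarith

theorem sq_mul_le_dotProduct_self (hS : IsUnit S.det) {σ : ℝ}
    (hσ : ∀ x, σ ^ 2 * (x ⬝ᵥ x) ≤ (S *ᵥ x) ⬝ᵥ (S *ᵥ x)) (x : Fin n → ℝ) :
    σ ^ 2 * ((S⁻¹ᵀ *ᵥ x) ⬝ᵥ (S⁻¹ᵀ *ᵥ x)) ≤ x ⬝ᵥ x := by
  have h0 := hσ (S⁻¹ *ᵥ (S⁻¹ᵀ *ᵥ x))
  rw [Matrix.mulVec_mulVec _ S, Matrix.mul_nonsing_inv _ hS, Matrix.one_mulVec] at h0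
  have h1 : (S⁻¹ *ᵥ (S⁻¹ᵀ *ᵥ x)) ⬝ᵥ x = (S⁻¹ᵀ *ᵥ x) ⬝ᵥ (S⁻¹ᵀ *ᵥ x) := by
    rw [mulVec_dotProduct_eq]
  have h2 := dotProduct_sq_le (S⁻¹ *ᵥ (S⁻¹ᵀ *ᵥ x)) x
  rw [h1] at h2
  have h3 := dotProduct_self_nonneg' x
  have h4 := dotProduct_self_nonneg' (S⁻¹ᵀ *ᵥ x)
  rcases h4.eq_or_lt with h | h
  · rw [← h]
    simpa using h3
  · refine le_of_mul_le_mul_right ?_ h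
    have h5 := mul_le_mul_of_nonneg_left h2 (sq_nonneg σ)
    have h6 := mul_le_mul_of_nonneg_right h0 h3
    nlinarith

theorem abs_dotProduct_le {k : ℕ} {x v : Fin k → ℝ} {s b : ℝ} (hs : 0 ≤ s) (hb : 0 ≤ b)
    (hx : x ⬝ᵥ x * k ≤ s ^ 2) (hv : ∀ i, |v i| ≤ b) : |x ⬝ᵥ v| ≤ s * b := by
  refine abs_le_of_sq_le_sq ?_ (by positivity)
  have h1 : v ⬝ᵥ v ≤ k * b ^ 2 := by
    calc v ⬝ᵥ v ≤ ∑ _i : Fin k, b ^ 2 := Finset.sum_le_sum fun i _ => by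
          rw [← sq, ← sq_abs]
          exact pow_le_pow_left₀ (abs_nonneg _) (hv i) 2
      _ = k * b ^ 2 := by simp
  calc (x ⬝ᵥ v) ^ 2 ≤ (x ⬝ᵥ x) * (v ⬝ᵥ v) := dotProduct_sq_le x v
    _ ≤ (x ⬝ᵥ x) * (k * b ^ 2) := mul_le_mul_of_nonneg_left h1 (dotProduct_self_nonneg' x)
    _ = x ⬝ᵥ x * k * b ^ 2 := by ring
    _ ≤ s ^ 2 * b ^ 2 := by gcongr
    _ = (s * b) ^ 2 := by ring

end Singular

/-- The Gaussian mass of a set of lattice vectors whose pairing with `v` is close to an integer,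
when a coordinate of `v` is far from the integers. -/
theorem gaussian_mass_near_int_le {n : ℕ} {C : Matrix (Fin n) (Fin n) ℝ} (hC : IsUnit C.det)
    {κ : ℝ} (hκ : ∀ l : Fin n, (C *ᵥ intCast' (Pi.single l 1)) ⬝ᵥ
      (C *ᵥ intCast' (Pi.single l 1)) ≤ κ) {v : Fin n → ℝ} {D : ℝ}
    (hv : ∃ l, ∀ k : ℤ, 2 * D ≤ |v l - k|) :
    (1 + Real.exp (-Real.pi * κ)) * ∑' x : Fin n → ℤ,
      (if ∃ k : ℤ, |intCast' x ⬝ᵥ v - k| < D then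
        Real.exp (-Real.pi * ((C *ᵥ intCast' x) ⬝ᵥ (C *ᵥ intCast' x))) else 0) ≤
      ∑' x : Fin n → ℤ, Real.exp (-Real.pi * ((C *ᵥ intCast' x) ⬝ᵥ (C *ᵥ intCast' x))) := by
  obtain ⟨l, hl⟩ := hv
  refine le_trans (mul_le_mul_of_nonneg_right ?_ ?_)
    (gaussian_mass_le_of_disjoint_translate hC (fun x => ∃ k : ℤ, |intCast' x ⬝ᵥ v - k| < D)
      (Pi.single l 1) ?_ ?_)
  · gcongr 1 + Real.exp ?_
    have := mul_le_mul_of_nonneg_left (hκ l) Real.pi_pos.le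
    linarith
  · exact tsum_nonneg fun x => by split_ifs; exacts [(Real.exp_pos _).le, le_rfl]
  · rintro x ⟨k, hk⟩
    refine ⟨-k, ?_⟩
    rw [intCast'_neg, neg_dotProduct, ← abs_neg]
    convert hk using 2
    push_cast
    ring
  · rintro x ⟨k, hk⟩ ⟨k', hk'⟩
    have h1 : intCast' (Pi.single l (1 : ℤ)) ⬝ᵥ v = v l := by
      have : intCast' (Pi.single l (1 : ℤ)) = Pi.single l (1 : ℝ) := by
        funext i
        by_cases h : i = l
        · subst h; simp [intCast']
        · simp [intCast', h]
      rw [this, single_one_dotProduct]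
    rw [intCast'_add, add_dotProduct, h1] at hk'
    have h2 := hl (k' - k)
    have h3 : v l - ((k' - k : ℤ) : ℝ) =
        (intCast' x ⬝ᵥ v + v l - k') - (intCast' x ⬝ᵥ v - k) := by
      push_cast
      ring
    rw [h3] at h2
    have h4 := abs_sub (intCast' x ⬝ᵥ v + v l - k') (intCast' x ⬝ᵥ v - k)
    linarith

theorem tsum_exp_neg_mul_int_sq_le {c : ℝ} (hc : 1 ≤ c) :
    ∑' a : ℤ, Real.exp (-c * (a : ℝ) ^ 2) ≤ 1 + 4 * Real.exp (-c) := by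
  set β := Real.exp (-c) with hβ
  have hβ0 : 0 < β := Real.exp_pos _
  have hβ1 : β ≤ 1 / 2 := by
    have h1 : β ≤ Real.exp (-1) := Real.exp_le_exp.2 (by linarith)
    have h2 := Real.exp_neg_one_lt_d9
    linarith
  have hle : ∀ k : ℕ, Real.exp (-c * (k : ℝ) ^ 2) ≤ β ^ k := by
    intro k
    rw [hβ, ← Real.exp_nat_mul, Real.exp_le_exp]
    have : (k : ℝ) ≤ (k : ℝ) ^ 2 := by exact_mod_cast Nat.le_self_pow two_ne_zero k
    nlinarith
  have hs := summable_exp_neg_mul_int_sq (c := c) (by linarith)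
  have hg := hasSum_geometric_of_lt_one hβ0.le (by linarith : β < 1)
  have h1 : Summable fun k : ℕ => Real.exp (-c * ((k : ℤ) : ℝ) ^ 2) :=
    hs.comp_injective (i := fun k : ℕ => (k : ℤ)) Nat.cast_injective
  have h2 : Summable fun k : ℕ => Real.exp (-c * ((-((k : ℤ) + 1) : ℤ) : ℝ) ^ 2) :=
    hs.comp_injective (i := fun k : ℕ => -((k : ℤ) + 1)) fun a b h => by simpa using h
  have h12 : HasSum (fun a : ℤ => Real.exp (-c * (a : ℝ) ^ 2)) _ :=
    HasSum.of_nat_of_neg_add_one h1.hasSum h2.hasSum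
  rw [h12.tsum_eq]
  have h3 : ∑' k : ℕ, Real.exp (-c * ((k : ℤ) : ℝ) ^ 2) ≤ (1 - β)⁻¹ := by
    refine hasSum_le (fun k => ?_) h1.hasSum hg
    rw [Int.cast_natCast]
    exact hle k
  have h4 : ∑' k : ℕ, Real.exp (-c * ((-((k : ℤ) + 1) : ℤ) : ℝ) ^ 2) ≤ β * (1 - β)⁻¹ := by
    refine hasSum_le (fun k => ?_) h2.hasSum (hg.mul_left β)
    have h := hle (k + 1)
    rw [pow_succ' β] at h
    rw [Int.cast_neg, neg_sq]
    exact_mod_cast h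
  have h5 : (1 - β)⁻¹ + β * (1 - β)⁻¹ ≤ 1 + 4 * β := by
    have : (1 - β)⁻¹ + β * (1 - β)⁻¹ = (1 + β) / (1 - β) := by
      rw [div_eq_mul_inv]; ring
    rw [this, div_le_iff₀ (by linarith)]
    nlinarith
  linarith

theorem tsum_exp_pow_le_one_add {c ε : ℝ} {m : ℕ} (hc : 1 ≤ c) (hε : ε ≤ 1)
    (h : 8 * m * Real.exp (-c) ≤ ε) :
    (∑' a : ℤ, Real.exp (-c * (a : ℝ) ^ 2)) ^ m ≤ 1 + ε := by
  have h0 : 0 ≤ (m : ℝ) * (4 * Real.exp (-c)) := by positivity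
  calc (∑' a : ℤ, Real.exp (-c * (a : ℝ) ^ 2)) ^ m ≤ Real.exp (4 * Real.exp (-c)) ^ m := by
        refine pow_le_pow_left₀ (tsum_nonneg fun _ => (Real.exp_pos _).le) ?_ m
        refine (tsum_exp_neg_mul_int_sq_le hc).trans ?_
        have := Real.add_one_le_exp (4 * Real.exp (-c))
        linarith
    _ = Real.exp (m * (4 * Real.exp (-c))) := (Real.exp_nat_mul _ m).symm
    _ ≤ 1 + 2 * (m * (4 * Real.exp (-c))) := by
        have h1 := Real.abs_exp_sub_one_le (x := m * (4 * Real.exp (-c)))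
          (by rw [abs_of_nonneg h0]; linarith)
        rw [abs_of_nonneg h0] at h1
        linarith [le_abs_self (Real.exp (m * (4 * Real.exp (-c))) - 1)]
    _ ≤ 1 + ε := by linarith

section Sampling

variable {n m : ℕ} {C : Matrix (Fin n) (Fin n) ℝ}

/-- Random Gaussian columns separate all the vectors of a grid from the integer vectors, and are
short. -/
theorem one_sub_le_tsum_of_short_separating (hC : IsUnit C.det) {κ t r : ℝ} {q : ℕ}
    (hκ : ∀ l : Fin n, (C *ᵥ intCast' (Pi.single l 1)) ⬝ᵥ
      (C *ᵥ intCast' (Pi.single l 1)) ≤ κ)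
    {p : (Fin n → ℤ) → ℝ}
    (hp : ∀ x, p x = Real.exp (-Real.pi * ((C *ᵥ intCast' x) ⬝ᵥ (C *ᵥ intCast' x))) /
      ∑' z : Fin n → ℤ, Real.exp (-Real.pi * ((C *ᵥ intCast' z) ⬝ᵥ (C *ᵥ intCast' z))))
    (good : (Fin m → Fin n → ℤ) → Prop)
    (hgood : ∀ y : Fin m → Fin n → ℤ,
      (∀ j, (C *ᵥ intCast' (y j)) ⬝ᵥ (C *ᵥ intCast' (y j)) ≤ t) →
      (∀ a : Fin n → Fin q, (∃ l, ∀ k : ℤ, 1 / (4 * r) ≤ |(a l : ℝ) / q - k|) →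
        ∃ j, ¬ ∃ k : ℤ, |intCast' (y j) ⬝ᵥ (fun l => (a l : ℝ) / q) - k| < 1 / (8 * r)) →
      good y) :
    1 - m * (2 ^ n * Real.exp (-(3 / 4 * Real.pi * t))) -
      (q : ℝ) ^ n * ((1 + Real.exp (-Real.pi * κ))⁻¹) ^ m ≤
      ∑' y : Fin m → Fin n → ℤ, if good y then ∏ j, p (y j) else 0 := by
  set f : (Fin n → ℤ) → ℝ := fun x =>
    Real.exp (-Real.pi * ((C *ᵥ intCast' x) ⬝ᵥ (C *ᵥ intCast' x))) with hf
  set Z := ∑' z, f z with hZ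
  have hfs : Summable f := summable_gaussian_int_zero hC
  have hZ0 : 0 < Z := hfs.tsum_pos (fun _ => (Real.exp_pos _).le) 0 (Real.exp_pos _)
  have hpf : p = fun x => f x / Z := funext hp
  have hp0 : ∀ x, 0 ≤ p x := fun x => by
    rw [hp]
    exact div_nonneg (Real.exp_pos _).le hZ0.le
  have hp1 : HasSum p 1 := by
    rw [hpf, ← div_self hZ0.ne']
    exact hfs.hasSum.div_const Z
  have hcond : ∀ E : (Fin n → ℤ) → Prop, ∑' x, (if E x then p x else 0) =
      (∑' x, if E x then f x else 0) / Z := by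
    intro E
    rw [← tsum_div_const]
    refine tsum_congr fun x => ?_
    rw [hpf]
    split_ifs <;> simp
  set s : Finset (Fin n → Fin q) :=
    Finset.univ.filter fun a => ∃ l, ∀ k : ℤ, 1 / (4 * r) ≤ |(a l : ℝ) / q - k| with hs
  have hE : 0 < 1 + Real.exp (-Real.pi * κ) := by positivity
  refine le_trans ?_ (one_sub_le_tsum_good hp0 hp1 s
    (fun a x => ∃ k : ℤ, |intCast' x ⬝ᵥ (fun l => (a l : ℝ) / q) - k| < 1 / (8 * r))
    (fun x => t < (C *ᵥ intCast' x) ⬝ᵥ (C *ᵥ intCast' x))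
    (P := (1 + Real.exp (-Real.pi * κ))⁻¹) (b := 2 ^ n * Real.exp (-(3 / 4 * Real.pi * t)))
    ?_ ?_ good ?_)
  · gcongr
    have : s.card ≤ q ^ n := (Finset.card_filter_le _ _).trans (by simp)
    exact_mod_cast this
  · intro a ha
    rw [hcond, div_le_iff₀ hZ0, ← div_eq_inv_mul, le_div_iff₀' hE]
    refine gaussian_mass_near_int_le hC hκ ?_
    rw [hs, Finset.mem_filter] at ha
    obtain ⟨l, hl⟩ := ha.2
    refine ⟨l, fun k => le_trans (le_of_eq ?_) (hl k)⟩
    rw [mul_one_div, show 8 * r = 2 * (4 * r) by ring, div_mul_eq_div_div, div_self two_ne_zero]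
  · rw [hcond, div_le_iff₀ hZ0]
    exact gaussian_tail_le hC t
  · intro y hB hA
    exact hgood y (fun j => not_lt.1 (hB j)) fun a ha => hA a (by rw [hs]; simpa using ha)

end Sampling

theorem mul_two_pow_mul_exp_le {n m : ℕ} (hn : 100 ≤ n) (hm : 2 ^ 14 ≤ m) :
    m * (2 ^ n * Real.exp (-(3 / 4 * Real.pi * (n * Real.logb 2 m / 16)))) ≤
      2⁻¹ * (2 : ℝ) ^ (-(n : ℤ)) := by
  have hn' : (100 : ℝ) ≤ n := by exact_mod_cast hn
  have hm' : (2 : ℝ) ^ 14 ≤ m := by exact_mod_cast hm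
  have hm0 : (0 : ℝ) < m := by linarith
  set L := Real.logb 2 m with hL
  have hL14 : 14 ≤ L := by
    rw [hL, Real.le_logb_iff_rpow_le (by norm_num) hm0]
    exact_mod_cast hm'
  have hlog2 := Real.log_two_lt_d9
  have hlog0 := Real.log_two_gt_d9
  have h2 : (2 : ℝ) = Real.exp (Real.log 2) := (Real.exp_log (by norm_num)).symm
  have hmL : (m : ℝ) = Real.exp (L * Real.log 2) := by
    rw [hL, Real.logb, div_mul_cancel₀ _ (by linarith), Real.exp_log hm0]
  have e1 : (2 : ℝ) ^ n = Real.exp (n * Real.log 2) := by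
    rw [Real.exp_nat_mul, Real.exp_log (by norm_num)]
  have e2 : 2⁻¹ * (2 : ℝ) ^ (-(n : ℤ)) = Real.exp (-Real.log 2 + -(n * Real.log 2)) := by
    rw [Real.exp_add, Real.exp_neg, Real.exp_neg, ← e1, ← h2, zpow_neg, zpow_natCast]
  rw [e1, e2, hmL, ← Real.exp_add, ← Real.exp_add, Real.exp_le_exp]
  have hpi := Real.pi_gt_d2
  have hnL : 0 < n * L := by positivity
  have h3 : 3.14 * (n * L) ≤ Real.pi * (n * L) := by gcongr
  have h4 : (L + 2 * n + 1) * Real.log 2 ≤ (L + 2 * n + 1) * 0.6931471808 := by gcongr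
  nlinarith

theorem pow_mul_inv_pow_le {n m q : ℕ} {s κ : ℝ} (hn : 100 ≤ n) (hs : 5 ≤ s)
    (hm : 30 * n * Real.logb 2 (n * s) ≤ m) (hq0 : 0 < q)
    (hq : q ≤ 2 * (n * s) ^ 2 * m) (hκ : Real.pi * κ ≤ 1 / 2) :
    (q : ℝ) ^ n * ((1 + Real.exp (-Real.pi * κ))⁻¹) ^ m ≤ 2⁻¹ * (2 : ℝ) ^ (-(n : ℤ)) := by
  have hn' : (100 : ℝ) ≤ n := by exact_mod_cast hn
  have hns : 500 ≤ n * s := by nlinarith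
  have hlog2 := Real.log_two_lt_d9
  have hlog0 := Real.log_two_gt_d9
  have h2 : (2 : ℝ) = Real.exp (Real.log 2) := (Real.exp_log (by norm_num)).symm
  set lam := Real.log (n * s) with hlam
  have hlam6 : 8 * Real.log 2 ≤ lam := by
    rw [hlam, show 8 * Real.log 2 = Real.log (2 ^ 8) by rw [Real.log_pow]; norm_num]
    exact Real.log_le_log (by norm_num) (by linarith)
  have hm1 : 30 * n * lam ≤ m * Real.log 2 := by
    rw [Real.logb, ← hlam, mul_div_assoc', div_le_iff₀ (by linarith)] at hm
    exact hm
  have hm0 : (0 : ℝ) < m := by nlinarith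
  have hq0' : (0 : ℝ) < q := by exact_mod_cast hq0
  have hq1 : Real.log q ≤ Real.log 2 + 2 * lam + Real.log m := by
    refine (Real.log_le_log hq0' hq).trans (le_of_eq ?_)
    rw [Real.log_mul (by positivity) hm0.ne', Real.log_mul (by norm_num) (by positivity),
      Real.log_pow, hlam]
    norm_num
  have hlm : n * Real.log m ≤ n * (8 * Real.log 2) + n * lam + m / 256 := by
    have h1 : Real.log m = Real.log (2 ^ 8) + Real.log n + Real.log (m / (256 * n)) := by
      rw [← Real.log_mul (by norm_num) (by positivity), ← Real.log_mul (by positivity)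
        (by positivity)]
      congr 1
      field_simp
      norm_num
    have h3 : Real.log (m / (256 * n)) ≤ m / (256 * n) := by
      have := Real.log_le_sub_one_of_pos (x := m / (256 * n)) (by positivity)
      linarith
    have h4 : Real.log n ≤ lam := Real.log_le_log (by linarith) (by nlinarith)
    have h5 : Real.log (2 ^ 8) = 8 * Real.log 2 := by rw [Real.log_pow]; norm_num
    calc (n : ℝ) * Real.log m ≤ n * (8 * Real.log 2 + lam + m / (256 * n)) := by
          rw [h1, h5]
          gcongr
      _ = _ := by field_simp
  have hP : (1 + Real.exp (-Real.pi * κ))⁻¹ ≤ Real.exp (-(Real.log 2 / 2)) := by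
    have h1 : Real.exp (Real.log 2 / 2) ≤ 3 / 2 := by
      refine abs_le_of_sq_le_sq' ?_ (by norm_num) |>.2
      rw [← Real.exp_nat_mul, show ((2 : ℕ) : ℝ) * (Real.log 2 / 2) = Real.log 2 by
        push_cast; ring, ← h2]
      norm_num
    have h3 : 1 / 2 ≤ Real.exp (-Real.pi * κ) := by
      have := Real.add_one_le_exp (-Real.pi * κ)
      linarith
    rw [Real.exp_neg]
    exact inv_anti₀ (Real.exp_pos _) (by linarith)
  have e1 : (2 : ℝ) ^ n = Real.exp (n * Real.log 2) := by
    rw [Real.exp_nat_mul, Real.exp_log (by norm_num)]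
  have e2 : 2⁻¹ * (2 : ℝ) ^ (-(n : ℤ)) = Real.exp (-Real.log 2 + -(n * Real.log 2)) := by
    rw [Real.exp_add, Real.exp_neg, Real.exp_neg, ← e1, ← h2, zpow_neg, zpow_natCast]
  calc (q : ℝ) ^ n * ((1 + Real.exp (-Real.pi * κ))⁻¹) ^ m
      ≤ (q : ℝ) ^ n * Real.exp (-(Real.log 2 / 2)) ^ m := by gcongr
    _ = Real.exp (n * Real.log q + m * -(Real.log 2 / 2)) := by
        rw [Real.exp_add, Real.exp_nat_mul, Real.exp_nat_mul, Real.exp_log hq0']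
    _ ≤ 2⁻¹ * (2 : ℝ) ^ (-(n : ℤ)) := by
        rw [e2, Real.exp_le_exp]
        have h3 : n * Real.log q ≤ n * (Real.log 2 + 2 * lam + Real.log m) := by gcongr
        have h4 : n * (8 * Real.log 2) ≤ n * lam := by gcongr
        have h5 : (m : ℝ) * 0.6931471803 ≤ m * Real.log 2 := by gcongr
        have h6 : 100 * Real.log 2 ≤ n * Real.log 2 := by gcongr
        linarith

theorem theta_condition {m : ℕ} {ε σ d ns : ℝ} (hm : 2 ≤ m) (hε0 : 0 < ε) (hε : ε < 1 / 1000)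
    (hns : 500 ≤ ns) (hd0 : 0 < d) (hd : d ^ 2 * (16 * ns ^ 2 * Real.logb 2 m) = 1)
    (hσ : 10 * ns * Real.logb 2 m *
      Real.sqrt (Real.logb 2 (1 / ε) * Real.logb 2 ns) ≤ σ) :
    (∑' a : ℤ, Real.exp (-(Real.pi * σ ^ 2 * d ^ 2 / 4) * (a : ℝ) ^ 2)) ^ m ≤ 1 + ε := by
  have hm' : (2 : ℝ) ≤ m := by exact_mod_cast hm
  have hm0 : (0 : ℝ) < m := by linarith
  have hlog2 := Real.log_two_lt_d9
  have hlog0 := Real.log_two_gt_d9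
  set L := Real.logb 2 m with hL
  set e := Real.logb 2 (1 / ε) with he
  set lam := Real.logb 2 ns with hlam
  have hL1 : 1 ≤ L := by
    rw [hL, Real.le_logb_iff_rpow_le (by norm_num) hm0]
    simpa using hm'
  have he1 : 1 ≤ e := by
    rw [he, Real.le_logb_iff_rpow_le (by norm_num) (by positivity), Real.rpow_one,
      le_div_iff₀ hε0]
    linarith
  have hlam8 : 8 ≤ lam := by
    rw [hlam, Real.le_logb_iff_rpow_le (by norm_num) (by linarith)]
    norm_num
    linarith
  have hmL : (m : ℝ) = Real.exp (L * Real.log 2) := by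
    rw [hL, Real.logb, div_mul_cancel₀ _ (by linarith), Real.exp_log hm0]
  have hεe : ε = Real.exp (-(e * Real.log 2)) := by
    rw [he, Real.logb, div_mul_cancel₀ _ (by linarith), Real.exp_neg, Real.exp_log (by positivity),
      one_div, inv_inv]
  have hσ2 : 100 * ns ^ 2 * L ^ 2 * (e * lam) ≤ σ ^ 2 := by
    have h1 := pow_le_pow_left₀ (by positivity) hσ 2
    rw [mul_pow, Real.sq_sqrt (by positivity)] at h1
    linarith
  have hc : 39 * (L * e) ≤ Real.pi * σ ^ 2 * d ^ 2 / 4 := by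
    have h1 : 50 * (L * e) ≤ σ ^ 2 * d ^ 2 := by
      calc 50 * (L * e) = 25 / 4 * (L * e) * 8 := by ring
        _ ≤ 25 / 4 * (L * e) * lam := by gcongr
        _ = 25 / 4 * (L * e) * lam * (d ^ 2 * (16 * ns ^ 2 * L)) := by rw [hd, mul_one]
        _ = 100 * ns ^ 2 * L ^ 2 * (e * lam) * d ^ 2 := by ring
        _ ≤ σ ^ 2 * d ^ 2 := by gcongr
    have hpi := Real.pi_gt_d2
    have h2 : 3.14 * (50 * (L * e)) ≤ Real.pi * (σ ^ 2 * d ^ 2) := by gcongr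
    have h3 : 0 < L * e := by positivity
    linarith
  have hLe : (L + e) / 2 ≤ L * e := by nlinarith
  refine tsum_exp_pow_le_one_add (by linarith) (by linarith) ?_
  have h8 : (8 : ℝ) = Real.exp (3 * Real.log 2) := by
    rw [show 3 * Real.log 2 = Real.log (2 ^ 3) by rw [Real.log_pow]; norm_num,
      Real.exp_log (by norm_num)]
    norm_num
  rw [h8, hmL, ← Real.exp_add, ← Real.exp_add]
  conv_rhs => rw [hεe]
  rw [Real.exp_le_exp]
  have h1 : L * Real.log 2 ≤ L * 1 := by gcongr; linarith
  have h2 : e * Real.log 2 ≤ e * 1 := by gcongr; linarith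
  linarith

/-- Theorem 5.1, main theorem.  Let `m > n ≥ 100`, `ε ∈ (0, 1/1000)`,
`R ∈ ℝ^{m×m}` invertible, `c ∈ ℝ^m`, `S ∈ ℝ^{n×n}` invertible, and draw the `m` columns of
`X ∈ ℤ^{n×m}` independently from `D_{ℤ^n,S}`.  If `m ≥ 30·n·log₂(σ₁(S)·n)`,
`σ_m(R) ≥ 10·n·σ₁(S)·log₂(m)·√(log₂(1/ε)·log₂(n·σ₁(S)))`, and
`σ_n(S) ≥ 9·√(ln(2n(1+1/ε))/π)`, then with probability at least `1 − 2^{−n}` over `X`,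
`Δ(E_{X,R,c}, D_{ℤ^n + Xc, RXᵀ}) ≤ 2ε`. -/
theorem statement9 {n m : ℕ} (hn : 100 ≤ n) (hm : n < m)
    (ε : ℝ) (hε0 : 0 < ε) (hε : ε < 1 / 1000)
    (R : Matrix (Fin m) (Fin m) ℝ) (hR : IsUnit R.det) (c : Fin m → ℝ)
    (S : Matrix (Fin n) (Fin n) ℝ) (hS : IsUnit S.det)
    (σ1 σn σm : ℝ)
    (hσ1 : ∀ x : Fin n → ℝ, enorm' (S *ᵥ x) ≤ σ1 * enorm' x)
    (hσn : ∀ x : Fin n → ℝ, σn * enorm' x ≤ enorm' (S *ᵥ x))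
    (hσm : ∀ x : Fin m → ℝ, σm * enorm' x ≤ enorm' (R *ᵥ x))
    (hmB : (m : ℝ) ≥ 30 * n * Real.logb 2 (σ1 * n))
    (hσmB : σm ≥ 10 * n * σ1 * Real.logb 2 m *
        Real.sqrt (Real.logb 2 (1 / ε) * Real.logb 2 (n * σ1)))
    (hσnB : σn ≥ 9 * Real.sqrt (Real.log (2 * n * (1 + 1 / ε)) / Real.pi)) :
    (∑' X : Matrix (Fin n) (Fin m) ℤ,
        if statDist X R c ≤ 2 * ε then
          ∏ j : Fin m,
            (rho S (intCast' (fun i => X i j)) / ∑' y : Fin n → ℤ, rho S (intCast' y))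
        else 0)
      ≥ 1 - (2 : ℝ) ^ (-(n : ℤ)) := by
  have hn' : (100 : ℝ) ≤ n := by exact_mod_cast hn
  -- size of the parameters
  have hσn5 : 9 ≤ σn := by
    refine le_trans ?_ hσnB
    have hlog : Real.pi ≤ Real.log (2 * n * (1 + 1 / ε)) := by
      have h1 : (1000 : ℝ) ≤ 1 / ε := by
        rw [le_div_iff₀ hε0]
        linarith
      have h2 : (2 : ℝ) ^ 10 ≤ 2 * n * (1 + 1 / ε) := by nlinarith
      have h3 := Real.log_le_log (by norm_num) h2
      rw [Real.log_pow] at h3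
      have h4 := Real.log_two_gt_d9
      have h5 := Real.pi_lt_d2
      push_cast at h3
      linarith
    have h1 : 1 ≤ Real.log (2 * n * (1 + 1 / ε)) / Real.pi := by
      rwa [le_div_iff₀ Real.pi_pos, one_mul]
    have h2 := Real.one_le_sqrt.2 h1
    linarith
  have hσ15 : 9 ≤ σ1 := by
    have h1 := (hσn (Pi.single ⟨0, by omega⟩ 1)).trans (hσ1 _)
    have h2 : enorm' (Pi.single (⟨0, by omega⟩ : Fin n) (1 : ℝ)) = 1 := by
      simp [enorm', Pi.single_apply]
    rw [h2] at h1
    linarith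
  have hns : 500 ≤ (n : ℝ) * σ1 := by nlinarith
  have hns0 : 0 < (n : ℝ) * σ1 := by linarith
  have hlam : 8 ≤ Real.logb 2 (n * σ1) := by
    rw [Real.le_logb_iff_rpow_le (by norm_num) hns0]
    norm_num
    linarith
  rw [mul_comm σ1] at hmB
  have hm14 : 2 ^ 14 ≤ m := by
    have : (2 : ℝ) ^ 14 ≤ m := by nlinarith
    exact_mod_cast this
  have hm0 : (0 : ℝ) < m := by
    have : 0 < m := by omega
    exact_mod_cast this
  set L := Real.logb 2 m with hL
  have hL14 : 14 ≤ L := by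
    rw [hL, Real.le_logb_iff_rpow_le (by norm_num) hm0]
    exact_mod_cast hm14
  have hLm : L ≤ m := by
    rw [hL, Real.logb_le_iff_le_rpow (by norm_num) hm0, Real.rpow_natCast]
    exact_mod_cast (Nat.lt_two_pow_self (n := m)).le
  set r := n * σ1 * Real.sqrt L / 4 with hr
  have hr2 : 16 * r ^ 2 = (n * σ1) ^ 2 * L := by
    rw [hr, div_pow, mul_pow, Real.sq_sqrt (by linarith)]
    ring
  have hr1 : 1 < r := by
    have h1 : 1 ≤ Real.sqrt L := Real.one_le_sqrt.2 (by linarith)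
    rw [hr]
    nlinarith
  have hr0 : 0 < r := by linarith
  set q := ⌈16 * r ^ 2⌉₊ with hq
  have hq1 : 16 * r ^ 2 ≤ q := Nat.le_ceil _
  have hq0 : 0 < q := Nat.ceil_pos.2 (by positivity)
  have hq2 : (q : ℝ) ≤ 2 * (n * σ1) ^ 2 * m := by
    have h1 := (Nat.ceil_lt_add_one (a := 16 * r ^ 2) (by positivity)).le
    have h2 : 1 ≤ 16 * r ^ 2 := by nlinarith
    calc (q : ℝ) ≤ 2 * (16 * r ^ 2) := by linarith
      _ = 2 * (n * σ1) ^ 2 * L := by rw [hr2]; ring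
      _ ≤ _ := by gcongr
  -- singular values
  have hS1 : ∀ x, (S *ᵥ x) ⬝ᵥ (S *ᵥ x) ≤ σ1 ^ 2 * (x ⬝ᵥ x) := fun x => by
    simpa using sq_mul_dotProduct_le_of_enorm'_le zero_le_one (by simpa using hσ1 x)
  have hSn : ∀ x, σn ^ 2 * (x ⬝ᵥ x) ≤ (S *ᵥ x) ⬝ᵥ (S *ᵥ x) := fun x => by
    simpa using sq_mul_dotProduct_le_of_enorm'_le (b := 1) (by linarith) (by simpa using hσn x)
  have hσm0 : 0 < σm := by
    refine lt_of_lt_of_le ?_ hσmB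
    have h1 : 0 < Real.logb 2 (1 / ε) := by
      refine Real.logb_pos (by norm_num) ?_
      rw [lt_div_iff₀ hε0]
      linarith
    have h2 : 0 < Real.sqrt (Real.logb 2 (1 / ε) * Real.logb 2 (n * σ1)) :=
      Real.sqrt_pos.2 (by positivity)
    positivity
  have hRm : ∀ x, σm ^ 2 * (x ⬝ᵥ x) ≤ (R *ᵥ x) ⬝ᵥ (R *ᵥ x) := fun x => by
    simpa using sq_mul_dotProduct_le_of_enorm'_le (b := 1) hσm0.le (by simpa using hσm x)
  have hC : IsUnit (S⁻¹ᵀ).det := by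
    rw [Matrix.det_transpose]
    exact Matrix.isUnit_nonsing_inv_det _ hS
  have hκ : ∀ l : Fin n, (S⁻¹ᵀ *ᵥ intCast' (Pi.single l 1)) ⬝ᵥ
      (S⁻¹ᵀ *ᵥ intCast' (Pi.single l 1)) ≤ 1 / 81 := by
    intro l
    have h1 := sq_mul_le_dotProduct_self hS hSn (intCast' (Pi.single l 1))
    have h2 : intCast' (Pi.single l 1) ⬝ᵥ intCast' (Pi.single l (1 : ℤ)) = 1 := by
      simp [intCast', dotProduct, Pi.single_apply]
    have h3 := dotProduct_self_nonneg' (S⁻¹ᵀ *ᵥ intCast' (Pi.single l 1))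
    rw [h2] at h1
    have h4 : (9 : ℝ) ^ 2 ≤ σn ^ 2 := pow_le_pow_left₀ (by norm_num) hσn5 2
    have h5 := (mul_le_mul_of_nonneg_right h4 h3).trans h1
    linarith
  have hθ : (∑' a : ℤ, Real.exp (-(Real.pi * σm ^ 2 * (1 / (16 * r)) ^ 2 / 4) *
      (a : ℝ) ^ 2)) ^ m ≤ 1 + ε := by
    refine theta_condition (ns := n * σ1) (by omega) hε0 hε hns (by positivity) ?_ ?_
    · rw [mul_assoc 16, ← hL, ← hr2]
      field_simp
    · rw [← mul_assoc 10]
      exact hσmB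
  -- a good choice of the columns
  have hgood : ∀ y : Fin m → Fin n → ℤ,
      (∀ j, (S⁻¹ᵀ *ᵥ intCast' (y j)) ⬝ᵥ (S⁻¹ᵀ *ᵥ intCast' (y j)) ≤ n * L / 16) →
      (∀ a : Fin n → Fin q, (∃ l, ∀ k : ℤ, 1 / (4 * r) ≤ |(a l : ℝ) / q - k|) →
        ∃ j, ¬ ∃ k : ℤ, |intCast' (y j) ⬝ᵥ (fun l => (a l : ℝ) / q) - k| < 1 / (8 * r)) →
      statDist (Matrix.of fun i j => y j i) R c ≤ 2 * ε := by
    intro y hshort hsep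
    have hy : ∀ j (v : Fin n → ℝ) (b : ℝ), 0 ≤ b → (∀ i, |v i| ≤ b) →
        |intCast' (y j) ⬝ᵥ v| ≤ r * b := by
      intro j v b hb hv
      refine abs_dotProduct_le hr0.le hb ?_ hv
      have h1 := dotProduct_self_le_sq_mul hS hS1 (intCast' (y j))
      calc _ ≤ σ1 ^ 2 * (n * L / 16) * n := by
            gcongr
            exact h1.trans (by gcongr; exact hshort j)
        _ = (16 * r ^ 2) / 16 := by rw [hr2]; ring
        _ = r ^ 2 := by ring
    have hcol : ∀ (u : Fin n → ℝ) (j : Fin m),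
        (((Matrix.of fun i j => y j i).map (Int.cast : ℤ → ℝ))ᵀ *ᵥ u) j = intCast' (y j) ⬝ᵥ u :=
      fun u j => rfl
    refine statDist_le_of_lattice_condition hR c (d := 1 / (16 * r)) (by positivity) hσm0 hRm hε0
      (by linarith) (fun u hu => ?_) (fun u g hu => ?_) hθ
    · exact eq_zero_of_forall_dotProduct_eq_zero hr1 hq1 hy hsep fun j => by
        rw [← hcol, hu, Pi.zero_apply]
    · obtain ⟨w, hw⟩ := exists_int_vector_dotProduct_eq hr1 hq1 hy hsep fun j => hu j
      exact ⟨w, funext hw⟩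
  have hmain := one_sub_le_tsum_of_short_separating (m := m) hC hκ
    (p := fun x => rho S (intCast' x) / ∑' z : Fin n → ℤ, rho S (intCast' z))
    (fun x => by simp only [rho_eq_exp])
    (fun y => statDist (Matrix.of fun i j => y j i) R c ≤ 2 * ε) hgood
  have hb1 := mul_two_pow_mul_exp_le hn hm14
  have hb2 := pow_mul_inv_pow_le (κ := 1 / 81) hn (by linarith : 5 ≤ σ1) hmB hq0 hq2
    (by linarith [Real.pi_lt_d2])
  let Ψ : (Fin m → Fin n → ℤ) ≃ Matrix (Fin n) (Fin m) ℤ :=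
    ⟨fun y => Matrix.of fun i j => y j i, fun X j i => X i j, fun _ => rfl, fun _ => rfl⟩
  rw [← Ψ.tsum_eq]
  refine le_trans ?_ hmain
  linarith
end
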